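/- There exists a function φ : ℕ → ℝ_{>0} such that for every c ∈ ℕ with c ≥ 1, every m ∈ ℕ with m ≥ 2, every choice of values ε_i(y) ∈ [-1,1] (for i ∈ {1,…,m}, y ∈ ℤ) satisfying V(s_1, ε_i(y))(0) = V(s_{i+1}, 0)(−y), and every adversary strategy b in the resulting c-vector game with m rounds, the bias achieved by b satisfies |E[O_I − O_I⁻]| ≤ φ(c)·log³ m / m. -/

import Mathlib

noncomputable def binPMF (n : ℕ) (ε : ℝ) (k : ℤ) : ℝ :=
  if ((n : ℤ) + k) % 2 = 0 ∧ -(n : ℤ) ≤ k ∧ k ≤ (n : ℤ) then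
    (n.choose (((n : ℤ) + k) / 2).toNat : ℝ) *
      ((1 + ε) / 2) ^ (((n : ℤ) + k) / 2).toNat *
      ((1 - ε) / 2) ^ (((n : ℤ) - k) / 2).toNat
  else 0

noncomputable def binTail (n : ℕ) (ε : ℝ) (k : ℤ) : ℝ :=
  ∑ t ∈ Finset.Icc k (n : ℤ), binPMF n ε t

def lRound (m i : ℕ) : ℕ := m + 1 - i

def sRound (m i : ℕ) : ℕ := ∑ j ∈ Finset.Icc i m, lRound m j

/-- `Y_r`: the partial sum `k₀ + X_1 + ⋯ + X_r` along a trajectory of coin outcomes. -/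
def partY (m : ℕ) (k0 : ℤ) (x : Fin m → ℤ) (r : ℕ) : ℤ :=
  k0 + ∑ j ∈ Finset.univ.filter (fun j : Fin m => (j : ℕ) < r), x j

/-- Probability of a full trajectory of coins and hints in the online binomial game:
round `i+1` flips `ℓ_{i+1} = m - i` coins (summing to `x i`) and then samples the hint
`h i` from the distribution `hint (i+1) (Y_{i+1})`. -/
noncomputable def trajProb {H : Type} (m : ℕ) (ε : ℝ) (k0 : ℤ) (hint : ℕ → ℤ → H → ℝ)
    (x : Fin m → ℤ) (h : Fin m → H) : ℝ :=
  ∏ i : Fin m,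
    (binPMF (lRound m ((i : ℕ) + 1)) ε (x i) *
      hint ((i : ℕ) + 1) (partY m k0 x ((i : ℕ) + 1)) (h i))

/-- `O_r⁻ = Pr[Y_m ≥ 0 ∣ Y_{r-1} = y]`. -/
noncomputable def roundOminus (m : ℕ) (ε : ℝ) (r : ℕ) (y : ℤ) : ℝ :=
  binTail (sRound m r) ε (-y)

/-- `O_r = Pr[Y_m ≥ 0 ∣ Y_{r-1} = y, H_r = hv]`, computed by Bayes' rule over the value
of the round-`r` coin sum. -/
noncomputable def roundO {H : Type} (m : ℕ) (ε : ℝ) (hint : ℕ → ℤ → H → ℝ)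
    (r : ℕ) (y : ℤ) (hv : H) : ℝ :=
  (∑ z ∈ Finset.Icc (-(lRound m r : ℤ)) (lRound m r : ℤ),
      binPMF (lRound m r) ε z * hint r (y + z) hv * binTail (sRound m (r + 1)) ε (-(y + z))) /
  (∑ z ∈ Finset.Icc (-(lRound m r : ℤ)) (lRound m r : ℤ),
      binPMF (lRound m r) ε z * hint r (y + z) hv)

/-- The first round (as an element of `Fin m`, round `i` corresponding to `(i : ℕ) + 1`)
in which the adversary strategy `b` aborts, or `none` if it never aborts. -/
noncomputable def stopIdx {H : Type} (m : ℕ) (k0 : ℤ) (b : ℕ → ℤ → H → Bool)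
    (x : Fin m → ℤ) (h : Fin m → H) : Option (Fin m) :=
  if hex : (Finset.univ.filter
      (fun i : Fin m => b ((i : ℕ) + 1) (partY m k0 x (i : ℕ)) (h i) = true)).Nonempty
  then some ((Finset.univ.filter
      (fun i : Fin m => b ((i : ℕ) + 1) (partY m k0 x (i : ℕ)) (h i) = true)).min' hex)
  else none

/-- `O_I - O_I⁻` along a trajectory; it is `0` when the adversary never aborts, since
`O_{m+1} = O_{m+1}⁻`. -/
noncomputable def trajGain {H : Type} (m : ℕ) (ε : ℝ) (k0 : ℤ) (hint : ℕ → ℤ → H → ℝ)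
    (b : ℕ → ℤ → H → Bool) (x : Fin m → ℤ) (h : Fin m → H) : ℝ :=
  match stopIdx m k0 b x h with
  | some i =>
      roundO m ε hint ((i : ℕ) + 1) (partY m k0 x (i : ℕ)) (h i) -
        roundOminus m ε ((i : ℕ) + 1) (partY m k0 x (i : ℕ))
  | none => 0

/-- The bias `|E[O_I - O_I⁻]|` achieved by the adversary strategy `b` in the online
binomial game with `m` rounds, coin parameter `ε`, offset `k0` and hint distributions
`hint`. -/
noncomputable def gameBias {H : Type} (m : ℕ) (ε : ℝ) (k0 : ℤ) (hint : ℕ → ℤ → H → ℝ)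
    (b : ℕ → ℤ → H → Bool) : ℝ :=
  |∑' q : (Fin m → ℤ) × (Fin m → H),
      trajProb m ε k0 hint q.1 q.2 * trajGain m ε k0 hint b q.1 q.2|

/-- The hint distribution of the vector game: in round `r`, the hint is a vector of `N`
i.i.d. `Bool`-valued entries (`true` standing for `1`, `false` for `-1`), each equal to
`true` with probability `(1 + epsf r y)/2`, given `Y_r = y`. -/
noncomputable def vectorHint (N : ℕ) (epsf : ℕ → ℤ → ℝ) : ℕ → ℤ → (Fin N → Bool) → ℝ :=
  fun r y v => ∏ j : Fin N, (if v j then (1 + epsf r y) / 2 else (1 - epsf r y) / 2)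

/-- Expectation of `f` under the sum of `n` independent uniform signs. -/
noncomputable def fairExp : ℕ → (ℤ → ℝ) → ℝ
  | 0, f => f 0
  | n + 1, f => (fairExp n (fun z => f (z + 1)) + fairExp n (fun z => f (z - 1))) / 2

theorem fairExp_const (n : ℕ) (a : ℝ) : fairExp n (fun _ => a) = a := by
  induction n with
  | zero => rfl
  | succ n ih => simp [fairExp, ih]

theorem fairExp_add (n : ℕ) (f g : ℤ → ℝ) :
    fairExp n (fun z => f z + g z) = fairExp n f + fairExp n g := by
  induction n generalizing f g with
  | zero => rfl
  | succ n ih => simp only [fairExp, ih]; ring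

theorem fairExp_mul_left (n : ℕ) (a : ℝ) (f : ℤ → ℝ) :
    fairExp n (fun z => a * f z) = a * fairExp n f := by
  induction n generalizing f with
  | zero => rfl
  | succ n ih => simp only [fairExp, ih]; ring

theorem fairExp_mono (n : ℕ) {f g : ℤ → ℝ} (h : ∀ z : ℤ, |z| ≤ n → f z ≤ g z) :
    fairExp n f ≤ fairExp n g := by
  induction n generalizing f g with
  | zero => exact h 0 (by simp)
  | succ n ih =>
    have h1 := ih (f := fun z => f (z + 1)) (g := fun z => g (z + 1))
      (fun z hz => h _ (by rw [abs_le] at hz ⊢; push_cast; omega))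
    have h2 := ih (f := fun z => f (z - 1)) (g := fun z => g (z - 1))
      (fun z hz => h _ (by rw [abs_le] at hz ⊢; push_cast; omega))
    simp only [fairExp]; linarith

theorem fairExp_nonneg (n : ℕ) {f : ℤ → ℝ} (h : ∀ z : ℤ, |z| ≤ n → 0 ≤ f z) :
    0 ≤ fairExp n f := by
  simpa [fairExp_const] using fairExp_mono n (f := fun _ => 0) (g := f) h

theorem fairExp_le_of_le (n : ℕ) {f : ℤ → ℝ} {a : ℝ} (h : ∀ z : ℤ, |z| ≤ n → f z ≤ a) :
    fairExp n f ≤ a := by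
  simpa [fairExp_const] using fairExp_mono n (f := f) (g := fun _ => a) h

theorem fairExp_add_coins (a b : ℕ) (f : ℤ → ℝ) :
    fairExp (a + b) f = fairExp a (fun z => fairExp b (fun w => f (z + w))) := by
  induction a generalizing f with
  | zero => simp [fairExp]
  | succ a ih =>
    rw [Nat.add_right_comm]
    simp only [fairExp, ih]
    congr 3 <;> ext z <;> congr 1 <;> ext w <;> congr 1 <;> ring

theorem fairExp_neg (n : ℕ) (f : ℤ → ℝ) : fairExp n (fun z => f (-z)) = fairExp n f := by
  induction n generalizing f with
  | zero => simp [fairExp]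
  | succ n ih =>
    simp only [fairExp]
    rw [← ih (fun z => f (z + 1)), ← ih (fun z => f (z - 1)), add_comm]
    simp only [neg_add, sub_eq_add_neg, neg_neg]

theorem fairExp_exp (n : ℕ) (t : ℝ) :
    fairExp n (fun z => Real.exp (t * z)) = Real.cosh t ^ n := by
  induction n with
  | zero => simp [fairExp]
  | succ n ih =>
    have h1 : ∀ z : ℤ, Real.exp (t * ((z + 1 : ℤ) : ℝ)) = Real.exp t * Real.exp (t * z) :=
      fun z => by rw [← Real.exp_add]; push_cast; ring_nf
    have h2 : ∀ z : ℤ, Real.exp (t * ((z - 1 : ℤ) : ℝ)) = Real.exp (-t) * Real.exp (t * z) :=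
      fun z => by rw [← Real.exp_add]; push_cast; ring_nf
    simp only [fairExp, h1, h2, fairExp_mul_left, ih, Real.cosh_eq, pow_succ]
    ring

theorem fairExp_exp_le (n : ℕ) (t : ℝ) :
    fairExp n (fun z => Real.exp (t * z)) ≤ Real.exp (n * (t ^ 2 / 2)) := by
  rw [fairExp_exp, Real.exp_nat_mul]
  exact pow_le_pow_left₀ (Real.cosh_pos t).le (Real.cosh_le_exp_half_sq t) n

theorem fairExp_exp_abs_le {n : ℕ} {t : ℝ} (ht : n * t ^ 2 ≤ 1) :
    fairExp n (fun z => Real.exp (t * |(z : ℝ)|)) ≤ 4 := by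
  have h1 : ∀ z : ℤ, |z| ≤ n →
      Real.exp (t * |(z : ℝ)|) ≤ Real.exp (t * z) + Real.exp (-t * z) := by
    intro z _
    rcases abs_cases (z : ℝ) with h | h <;> rw [h.1]
    · linarith [Real.exp_pos (-t * z)]
    · rw [mul_neg, ← neg_mul]; linarith [Real.exp_pos (t * z)]
  have h2 := fairExp_mono n h1
  rw [fairExp_add] at h2
  have h3 := fairExp_exp_le n t
  have h4 := fairExp_exp_le n (-t)
  have h5 : Real.exp (n * (t ^ 2 / 2)) ≤ 2 := by
    rw [← Real.le_log_iff_exp_le (by norm_num)]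
    linarith [Real.log_two_gt_d9]
  rw [neg_sq] at h4
  linarith

/-- Hoeffding's inequality for fair signs. -/
theorem fairExp_tail_le {n k : ℕ} (hk : n ≤ k ^ 2) (hk0 : 0 < k) (l : ℝ) (hl : 0 ≤ l) :
    fairExp n (fun z => if l * k ≤ (z : ℝ) then 1 else 0) ≤ Real.exp (-(l ^ 2 / 2)) := by
  have hk' : (0 : ℝ) < k := by exact_mod_cast hk0
  have h1 : ∀ z : ℤ, |z| ≤ n → (if l * k ≤ (z : ℝ) then (1 : ℝ) else 0) ≤
      Real.exp (-l ^ 2) * Real.exp (l / k * z) := by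
    intro z _
    split_ifs with h
    · rw [← Real.exp_add]
      apply Real.one_le_exp
      have : l / k * (l * k) ≤ l / k * z := mul_le_mul_of_nonneg_left h (by positivity)
      have e : l / k * (l * k) = l ^ 2 := by field_simp
      linarith
    · positivity
  refine (fairExp_mono n h1).trans ?_
  rw [fairExp_mul_left]
  refine (mul_le_mul_of_nonneg_left (fairExp_exp_le n _) (Real.exp_pos _).le).trans ?_
  rw [← Real.exp_add]
  apply Real.exp_le_exp.2
  have hk2 : (n : ℝ) ≤ k ^ 2 := by exact_mod_cast hk
  have : n * ((l / k) ^ 2 / 2) ≤ k ^ 2 * ((l / k) ^ 2 / 2) :=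
    mul_le_mul_of_nonneg_right hk2 (by positivity)
  have e : (k : ℝ) ^ 2 * ((l / k) ^ 2 / 2) = l ^ 2 / 2 := by field_simp
  linarith

theorem fairExp_abs_tail_le {n k : ℕ} (hk : n ≤ k ^ 2) (hk0 : 0 < k) (l : ℝ) (hl : 0 ≤ l) :
    fairExp n (fun z => if l * k ≤ |(z : ℝ)| then 1 else 0) ≤ 2 * Real.exp (-(l ^ 2 / 2)) := by
  have h := fairExp_tail_le hk hk0 l hl
  have h' := h
  rw [← fairExp_neg] at h'
  have := fairExp_mono n (f := fun z => if l * k ≤ |(z : ℝ)| then (1 : ℝ) else 0)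
    (g := fun z => (if l * k ≤ (z : ℝ) then (1 : ℝ) else 0) +
      (if l * k ≤ ((-z : ℤ) : ℝ) then 1 else 0)) (by
      intro z _
      simp only [le_abs, Int.cast_neg]
      by_cases h1 : l * k ≤ (z : ℝ) <;> by_cases h2 : l * k ≤ -(z : ℝ) <;> simp [h1, h2])
  rw [fairExp_add] at this
  linarith

theorem sum_binPMF_mul (n : ℕ) (e : ℝ) (f : ℤ → ℝ) :
    ∑ z ∈ Finset.Icc (-(n : ℤ)) n, binPMF n e z * f z =
      ∑ i ∈ Finset.range (n + 1),
        (n.choose i : ℝ) * ((1 + e) / 2) ^ i * ((1 - e) / 2) ^ (n - i) * f (2 * i - n) := by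
  symm
  refine Finset.sum_of_injOn (fun i : ℕ => (2 * i - n : ℤ)) ?_ ?_ ?_ ?_
  · intro a _ b _ h; simp only at h; omega
  · intro i hi
    simp only [Finset.coe_range, Set.mem_Iio, Finset.coe_Icc, Set.mem_Icc] at hi ⊢
    omega
  · intro z hz hz'
    simp only [Finset.coe_range, Set.mem_image, Set.mem_Iio, not_exists, not_and,
      Finset.mem_Icc] at hz hz'
    have : ¬ (((n : ℤ) + z) % 2 = 0 ∧ -(n : ℤ) ≤ z ∧ z ≤ (n : ℤ)) := by
      rintro ⟨h, h1, h2⟩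
      exact hz' (((n : ℤ) + z) / 2).toNat (by omega) (by omega)
    rw [binPMF, if_neg this, zero_mul]
  · intro i hi
    rw [Finset.mem_range] at hi
    have h1 : ((n : ℤ) + (2 * i - n)) % 2 = 0 ∧ -(n : ℤ) ≤ 2 * i - n ∧ 2 * i - n ≤ (n : ℤ) := by
      omega
    have h2 : (((n : ℤ) + (2 * i - n)) / 2).toNat = i := by omega
    have h3 : (((n : ℤ) - (2 * i - n)) / 2).toNat = n - i := by omega
    simp only [binPMF, h2, h3]
    rw [if_pos h1]

theorem fairExp_eq_sum_choose (n : ℕ) (f : ℤ → ℝ) :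
    fairExp n f = (∑ i ∈ Finset.range (n + 1), (n.choose i : ℝ) * f (2 * i - n)) / 2 ^ n := by
  induction n generalizing f with
  | zero => simp [fairExp]
  | succ n ih =>
    have h := Finset.sum_choose_succ_mul (fun i _ => f (2 * i - (n + 1 : ℕ))) n
    rw [h, fairExp, ih, ih, pow_succ]
    have e1 : ∀ i : ℕ, (2 * i - n - 1 : ℤ) = 2 * i - (n + 1 : ℕ) := fun i => by push_cast; ring
    have e2 : ∀ i : ℕ, (2 * i - n + 1 : ℤ) = 2 * (i + 1 : ℕ) - (n + 1 : ℕ) :=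
      fun i => by push_cast; ring
    simp only [e1, e2]
    field_simp
    ring

theorem sum_binPMF_zero_mul (n : ℕ) (f : ℤ → ℝ) :
    ∑ z ∈ Finset.Icc (-(n : ℤ)) n, binPMF n 0 z * f z = fairExp n f := by
  rw [sum_binPMF_mul, fairExp_eq_sum_choose, Finset.sum_div]
  refine Finset.sum_congr rfl fun i hi => ?_
  have : i + (n - i) = n := by rw [Finset.mem_range] at hi; omega
  have e : ((1 + 0 : ℝ) / 2) ^ i * ((1 - 0) / 2) ^ (n - i) = 1 / 2 ^ n := by
    rw [add_zero, sub_zero, ← pow_add, this]; simp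
  rw [mul_assoc (n.choose i : ℝ), e]; ring

theorem binPMF_eq_zero {n : ℕ} {e : ℝ} {z : ℤ} (h : ¬ |z| ≤ n) : binPMF n e z = 0 := by
  rw [abs_le] at h
  simp only [binPMF]
  rw [if_neg (fun h' => h h'.2)]

theorem binTail_eq (n : ℕ) (e : ℝ) (k : ℤ) :
    binTail n e k =
      ∑ z ∈ Finset.Icc (-(n : ℤ)) n, binPMF n e z * (if k ≤ z then 1 else 0) := by
  simp only [mul_ite, mul_one, mul_zero]
  rw [← Finset.sum_filter, binTail]
  symm
  apply Finset.sum_subset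
  · intro z hz; simp only [Finset.mem_filter, Finset.mem_Icc] at hz ⊢; omega
  · intro z hz hz'
    simp only [Finset.mem_filter, Finset.mem_Icc] at hz hz'
    exact binPMF_eq_zero (by rw [abs_le]; omega)

theorem binTail_zero_eq (n : ℕ) (k : ℤ) :
    binTail n 0 k = fairExp n (fun z => if k ≤ z then 1 else 0) := by
  rw [binTail_eq, sum_binPMF_zero_mul]

theorem binPMF_zero_nonneg (n : ℕ) (z : ℤ) : 0 ≤ binPMF n 0 z := by
  simp only [binPMF]; split_ifs <;> norm_num

theorem binTail_add_coins (a b : ℕ) (y : ℤ) :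
    binTail (a + b) 0 (-y) = fairExp a (fun z => binTail b 0 (-(y + z))) := by
  simp only [binTail_zero_eq]
  rw [fairExp_add_coins]
  congr 1; ext z; congr 1; ext w; congr 1
  apply propext; constructor <;> intro <;> omega

theorem binTail_zero_nonneg (n : ℕ) (k : ℤ) : 0 ≤ binTail n 0 k := by
  rw [binTail_zero_eq]; exact fairExp_nonneg n fun z _ => by split_ifs <;> norm_num

theorem binTail_zero_le_one (n : ℕ) (k : ℤ) : binTail n 0 k ≤ 1 := by
  rw [binTail_zero_eq]; exact fairExp_le_of_le n fun z _ => by split_ifs <;> norm_num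

/-- The probability that the complementary tail is hit. -/
theorem one_sub_binTail_zero (n : ℕ) (k : ℤ) : 1 - binTail n 0 k = binTail n 0 (1 - k) := by
  have h : binTail n 0 k + binTail n 0 (1 - k) = 1 := by
    rw [binTail_zero_eq, binTail_zero_eq, ← fairExp_neg n (fun z => if 1 - k ≤ z then 1 else 0),
      ← fairExp_add]
    refine (congrArg (fairExp n) (funext fun z => ?_)).trans (fairExp_const n 1)
    by_cases h : k ≤ z
    · rw [if_pos h, if_neg (by omega), add_zero]
    · rw [if_neg h, if_pos (by omega), zero_add]
  linarith

theorem centralBinom_sq_upper (k : ℕ) :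
    (2 * k + 1 : ℝ) * (Nat.centralBinom k : ℝ) ^ 2 ≤ 16 ^ k := by
  induction k with
  | zero => simp
  | succ k ih =>
    have h : ((k : ℝ) + 1) * (Nat.centralBinom (k + 1) : ℝ) =
        2 * (2 * k + 1) * Nat.centralBinom k := by
      exact_mod_cast Nat.succ_mul_centralBinom_succ k
    have hk : (0 : ℝ) < (k : ℝ) + 1 := by positivity
    have e : (Nat.centralBinom (k + 1) : ℝ) = 2 * (2 * k + 1) * Nat.centralBinom k / (k + 1) := by
      rw [eq_div_iff hk.ne', ← h]; ring
    rw [e, pow_succ (16 : ℝ), div_pow, mul_div_assoc', div_le_iff₀ (by positivity)]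
    push_cast
    have h1 : (4 * (2 * k + 1) * (2 * k + 3) : ℝ) ≤ 16 * ((k : ℝ) + 1) ^ 2 := by nlinarith
    calc _ = (4 * (2 * k + 1) * (2 * k + 3) : ℝ) *
          ((2 * k + 1) * (Nat.centralBinom k : ℝ) ^ 2) := by ring
      _ ≤ (16 * ((k : ℝ) + 1) ^ 2) * 16 ^ k := by gcongr
      _ = _ := by ring

theorem centralBinom_sq_lower {k : ℕ} (hk : 1 ≤ k) :
    (16 : ℝ) ^ k ≤ 4 * k * (Nat.centralBinom k : ℝ) ^ 2 := by
  induction k, hk using Nat.le_induction with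
  | base => norm_num [Nat.centralBinom]
  | succ k _ ih =>
    have h : ((k : ℝ) + 1) * (Nat.centralBinom (k + 1) : ℝ) =
        2 * (2 * k + 1) * Nat.centralBinom k := by
      exact_mod_cast Nat.succ_mul_centralBinom_succ k
    have hk : (0 : ℝ) < (k : ℝ) + 1 := by positivity
    have e : (Nat.centralBinom (k + 1) : ℝ) = 2 * (2 * k + 1) * Nat.centralBinom k / (k + 1) := by
      rw [eq_div_iff hk.ne', ← h]; ring
    rw [e, pow_succ (16 : ℝ), div_pow, mul_div_assoc', le_div_iff₀ (by positivity)]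
    push_cast
    calc _ ≤ (4 * k * (Nat.centralBinom k : ℝ) ^ 2) * 16 * ((k : ℝ) + 1) ^ 2 := by gcongr
      _ = (16 * (k * (k + 1))) * (4 * (k + 1) * (Nat.centralBinom k : ℝ) ^ 2) := by ring
      _ ≤ (4 * (2 * k + 1) ^ 2) * (4 * (k + 1) * (Nat.centralBinom k : ℝ) ^ 2) := by
          refine mul_le_mul_of_nonneg_right ?_ (by positivity)
          nlinarith
      _ = _ := by ring

theorem two_mul_choose_odd (k : ℕ) :
    2 * ((2 * k + 1).choose k : ℝ) = Nat.centralBinom (k + 1) := by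
  have h1 : Nat.centralBinom (k + 1) = (2 * k + 1).choose k + (2 * k + 1).choose (k + 1) := by
    rw [Nat.centralBinom, show 2 * (k + 1) = (2 * k + 1) + 1 by ring, Nat.choose_succ_succ]
  rw [h1, Nat.choose_symm_half]; push_cast; ring

theorem choose_half_sq_upper (n : ℕ) :
    (n + 1 : ℝ) * (n.choose (n / 2) : ℝ) ^ 2 ≤ 4 ^ n := by
  rcases Nat.even_or_odd' n with ⟨k, rfl | rfl⟩
  · have := centralBinom_sq_upper k
    rw [Nat.mul_div_cancel_left k two_pos, pow_mul]
    norm_num [Nat.centralBinom] at this ⊢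
    exact this
  · have := centralBinom_sq_upper (k + 1)
    rw [← two_mul_choose_odd, mul_pow, pow_succ (16 : ℝ)] at this
    rw [show (2 * k + 1) / 2 = k by omega, pow_succ (4 : ℝ), pow_mul]
    push_cast at this ⊢
    norm_num
    nlinarith [sq_nonneg ((2 * k + 1).choose k : ℝ)]

theorem choose_half_sq_lower (n : ℕ) :
    (4 : ℝ) ^ n ≤ (2 * n + 2) * (n.choose (n / 2) : ℝ) ^ 2 := by
  rcases Nat.even_or_odd' n with ⟨k, rfl | rfl⟩
  · rw [Nat.mul_div_cancel_left k two_pos, pow_mul]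
    rcases Nat.eq_zero_or_pos k with rfl | hk
    · norm_num
    · have := centralBinom_sq_lower hk
      rw [Nat.centralBinom] at this
      push_cast
      norm_num
      nlinarith [sq_nonneg ((2 * k).choose k : ℝ)]
  · have := centralBinom_sq_lower (k := k + 1) (by omega)
    rw [← two_mul_choose_odd, mul_pow, pow_succ (16 : ℝ)] at this
    rw [show (2 * k + 1) / 2 = k by omega, pow_succ (4 : ℝ), pow_mul]
    push_cast at this ⊢
    norm_num
    nlinarith [sq_nonneg ((2 * k + 1).choose k : ℝ)]

theorem binPMF_zero_eq (n : ℕ) (i : ℕ) :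
    binPMF n 0 (2 * i - n) = (n.choose i : ℝ) / 2 ^ n := by
  simp only [binPMF]
  split_ifs with h
  · have h2 : (((n : ℤ) + (2 * i - n)) / 2).toNat = i := by omega
    have h3 : (((n : ℤ) - (2 * i - n)) / 2).toNat = n - i := by omega
    have h4 : i + (n - i) = n := by omega
    rw [h2, h3, mul_assoc, add_zero, sub_zero, ← pow_add, h4]; simp [div_eq_mul_inv]
  · rw [Nat.choose_eq_zero_of_lt (by omega)]; simp

theorem binPMF_zero_sq_le (n : ℕ) (z : ℤ) : (n + 1 : ℝ) * binPMF n 0 z ^ 2 ≤ 1 := by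
  by_cases h : ((n : ℤ) + z) % 2 = 0 ∧ -(n : ℤ) ≤ z ∧ z ≤ (n : ℤ)
  · obtain ⟨i, rfl⟩ : ∃ i : ℕ, z = 2 * i - n := ⟨(((n : ℤ) + z) / 2).toNat, by omega⟩
    rw [binPMF_zero_eq, div_pow, ← pow_mul, mul_comm n 2, pow_mul, ← mul_div_assoc,
      div_le_one (by positivity)]
    have h1 : (n.choose i : ℝ) ≤ n.choose (n / 2) := by exact_mod_cast Nat.choose_le_middle i n
    refine le_trans ?_ ((choose_half_sq_upper n).trans_eq (by norm_num))
    gcongr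
  · rw [binPMF, if_neg h]; norm_num

theorem binPMF_zero_le {n : ℕ} {x : ℝ} (hx : 0 < x) (hn : x ^ 2 ≤ n + 1) (z : ℤ) :
    binPMF n 0 z ≤ 1 / x := by
  rw [le_div_iff₀ hx]
  apply le_of_sq_le_sq _ (by norm_num)
  have := binPMF_zero_sq_le n z
  nlinarith [mul_le_mul_of_nonneg_right hn (sq_nonneg (binPMF n 0 z))]

theorem binPMF_zero_step (n : ℕ) (k : ℤ) :
    (n + k + 2 : ℝ) * binPMF n 0 (k + 2) = (n - k : ℝ) * binPMF n 0 k := by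
  by_cases h : ((n : ℤ) + k) % 2 = 0
  · by_cases h1 : 0 ≤ (n : ℤ) + k
    · obtain ⟨i, rfl⟩ : ∃ i : ℕ, k = 2 * i - n := ⟨(((n : ℤ) + k) / 2).toNat, by omega⟩
      rw [show (2 * i - n + 2 : ℤ) = 2 * (i + 1 : ℕ) - n by push_cast; ring, binPMF_zero_eq,
        binPMF_zero_eq]
      have h2 : ((n.choose (i + 1) : ℕ) : ℝ) * (i + 1) = n.choose i * (n - i) := by
        rcases le_or_gt i n with hi | hi
        · have := Nat.choose_succ_right_eq n i
          rw [← Nat.cast_sub hi]; exact_mod_cast this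
        · rw [Nat.choose_eq_zero_of_lt hi, Nat.choose_eq_zero_of_lt (by omega)]; simp
      push_cast
      field_simp
      linarith
    · have e : binPMF n 0 k = 0 := by rw [binPMF, if_neg (by omega)]
      rw [e]
      by_cases h2 : (n : ℤ) + k + 2 = 0
      · have : (n + k + 2 : ℝ) = 0 := by exact_mod_cast h2
        rw [this]; simp
      · rw [binPMF, if_neg (by omega)]; simp
  · rw [binPMF, if_neg (by omega), binPMF, if_neg (by omega)]; simp

theorem binTail_step (n : ℕ) (e : ℝ) (k : ℤ) :
    binTail n e k = binPMF n e k + binTail n e (k + 1) := by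
  by_cases h : k ≤ n
  · rw [binTail, binTail, ← Finset.sum_singleton (binPMF n e) k, ← Finset.sum_union]
    · congr 1; ext t; simp only [Finset.mem_Icc, Finset.mem_union, Finset.mem_singleton]; omega
    · rw [Finset.disjoint_left]; simp
  · rw [binPMF_eq_zero (by rw [abs_le]; omega), binTail, binTail, Finset.Icc_eq_empty (by omega),
      Finset.Icc_eq_empty (by omega)]; simp

theorem binTail_zero_anti (n : ℕ) {k l : ℤ} (h : k ≤ l) : binTail n 0 l ≤ binTail n 0 k := by
  rw [binTail_zero_eq, binTail_zero_eq]
  exact fairExp_mono n fun z _ => by split_ifs <;> first | omega | norm_num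

theorem sum_binPMF_le_binTail (n : ℕ) (k : ℤ) (J : ℕ) :
    ∑ j ∈ Finset.range J, binPMF n 0 (k + 2 * (j + 1)) ≤ binTail n 0 (k + 1) := by
  induction J generalizing k with
  | zero => simpa using binTail_zero_nonneg n (k + 1)
  | succ J ih =>
    rw [Finset.sum_range_succ', binTail_step, binTail_step]
    have h := ih (k + 2)
    have h1 := binPMF_zero_nonneg n (k + 1)
    have e1 : (k + 2 + 1 : ℤ) = k + 1 + 1 + 1 := by ring
    have e2 : (k + 2 * ((0 : ℕ) + 1) : ℤ) = k + 1 + 1 := by push_cast; ring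
    have e3 : ∀ j : ℕ, (k + 2 + 2 * (j + 1) : ℤ) = k + 2 * ((j + 1 : ℕ) + 1) :=
      fun j => by push_cast; ring
    simp only [e3] at h
    rw [e1] at h
    rw [e2]
    linarith

/-- Upper bound on the hazard rate of the fair binomial distribution. -/
theorem binPMF_hazard {s J : ℕ} {k B : ℤ} (hk : -(s : ℤ) ≤ k) (hB : k + 2 * J ≤ B) (hB0 : 0 ≤ B)
    (hJ : 4 * J * (B + 1) ≤ s) (hs : 0 < s) :
    J * binPMF s 0 k ≤ 2 * binTail s 0 (k + 1) := by
  rcases Nat.eq_zero_or_pos J with rfl | hJ0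
  · simpa using binTail_zero_nonneg s (k + 1)
  have hs' : (0 : ℝ) < s := by exact_mod_cast hs
  have hJ' : 4 * (J : ℝ) * (B + 1) ≤ s := by exact_mod_cast hJ
  have hB' : (0 : ℝ) ≤ B := by exact_mod_cast hB0
  have hJ1 : (1 : ℝ) ≤ J := by exact_mod_cast hJ0
  set r : ℝ := 1 - 2 * (B + 1) / s with hr
  have hr0 : 0 ≤ r := by
    rw [hr, sub_nonneg, div_le_one hs']; nlinarith
  have hr1 : r ≤ 1 := by rw [hr]; linarith [show 0 ≤ 2 * ((B : ℝ) + 1) / s by positivity]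
  have step : ∀ l : ℤ, -(s : ℤ) ≤ l → l ≤ B → r * binPMF s 0 l ≤ binPMF s 0 (l + 2) := by
    intro l hl hlB
    have hl' : (0 : ℝ) < s + l + 2 := by
      have : (0 : ℤ) < s + l + 2 := by omega
      exact_mod_cast this
    have hlB' : (l : ℝ) ≤ B := by exact_mod_cast hlB
    have h := binPMF_zero_step s l
    have h2 : (s + l + 2 : ℝ) * r ≤ s - l := by
      have : (2 * (l + 1) : ℝ) ≤ (s + l + 2) * (2 * (B + 1) / s) := by
        rcases le_or_gt (l + 1 : ℝ) 0 with h0 | h0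
        · refine le_trans (by linarith) (show (0 : ℝ) ≤ _ by positivity)
        · rw [← mul_div_assoc, le_div_iff₀ hs']
          nlinarith
      rw [hr]; linarith
    have h3 := mul_le_mul_of_nonneg_right h2 (binPMF_zero_nonneg s l)
    rw [← h, mul_assoc] at h3
    exact le_of_mul_le_mul_left h3 hl'
  have pw : ∀ j : ℕ, j ≤ J → r ^ j * binPMF s 0 k ≤ binPMF s 0 (k + 2 * j) := by
    intro j
    induction j with
    | zero => simp
    | succ j ih =>
      intro hj
      have h1 := step (k + 2 * j) (by omega) (by omega)
      have h2 := mul_le_mul_of_nonneg_left (ih (by omega)) hr0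
      rw [show (k + 2 * (j + 1 : ℕ) : ℤ) = k + 2 * j + 2 by push_cast; ring, pow_succ']
      linarith
  have half : 1 / 2 ≤ r ^ J := by
    have h := one_add_mul_le_pow (a := r - 1) (by linarith) J
    rw [add_sub_cancel] at h
    refine le_trans ?_ h
    have : J * (2 * ((B : ℝ) + 1) / s) ≤ 1 / 2 := by
      rw [← mul_div_assoc, div_le_iff₀ hs']; linarith
    rw [hr]; linarith
  have hsum : ∑ j ∈ Finset.range J, 1 / 2 * binPMF s 0 k ≤
      ∑ j ∈ Finset.range J, binPMF s 0 (k + 2 * (j + 1)) := by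
    refine Finset.sum_le_sum fun j hj => ?_
    rw [Finset.mem_range] at hj
    have h1 := pw (j + 1) hj
    push_cast at h1
    refine le_trans ?_ h1
    exact mul_le_mul_of_nonneg_right
      (half.trans (pow_le_pow_of_le_one hr0 hr1 hj)) (binPMF_zero_nonneg s k)
  have := hsum.trans (sum_binPMF_le_binTail s k J)
  rw [Finset.sum_const, Finset.card_range, nsmul_eq_mul] at this
  linarith

/-- Probability that at least `a` of `n` independent `p`-coins succeed. -/
noncomputable def upperTail (n a : ℕ) (p : ℝ) : ℝ :=
  ∑ i ∈ Finset.Icc a n, (n.choose i : ℝ) * p ^ i * (1 - p) ^ (n - i)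

theorem binTail_eq_upperTail (n : ℕ) (e : ℝ) :
    binTail n e 0 = upperTail n ((n + 1) / 2) ((1 + e) / 2) := by
  rw [binTail_eq, sum_binPMF_mul, upperTail, show 1 - (1 + e) / 2 = (1 - e) / 2 by ring]
  simp only [mul_ite, mul_one, mul_zero]
  rw [← Finset.sum_filter]
  refine Finset.sum_congr ?_ fun _ _ => rfl
  ext i; simp only [Finset.mem_filter, Finset.mem_range, Finset.mem_Icc]; omega

theorem upperTail_step {n a : ℕ} (h : a ≤ n) (p : ℝ) :
    upperTail n a p = n.choose a * p ^ a * (1 - p) ^ (n - a) + upperTail n (a + 1) p := by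
  rw [upperTail, upperTail, ← Finset.insert_Icc_add_one_left_eq_Icc h, Finset.sum_insert (by simp)]

theorem hasDerivAt_upperTail {n a : ℕ} (ha : 1 ≤ a) (han : a ≤ n + 1) (p : ℝ) :
    HasDerivAt (upperTail n a) (a * n.choose a * p ^ (a - 1) * (1 - p) ^ (n - a)) p := by
  induction han using Nat.decreasingInduction with
  | self =>
    have : upperTail n (n + 1) = fun _ => 0 := by ext p; simp [upperTail]
    rw [this, Nat.choose_succ_self]; simpa using hasDerivAt_const p (0 : ℝ)
  | of_succ a h ih =>
    have h := Nat.lt_succ_iff.1 h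
    rw [show upperTail n a = fun p => n.choose a * p ^ a * (1 - p) ^ (n - a) +
      upperTail n (a + 1) p from funext (upperTail_step h)]
    have h1 : HasDerivAt (fun p : ℝ => (1 - p) ^ (n - a))
        (((n - a : ℕ) : ℝ) * (1 - p) ^ (n - a - 1) * (-1)) p :=
      ((hasDerivAt_id p).const_sub 1).fun_pow (n - a)
    have h2 : HasDerivAt (fun p : ℝ => (n.choose a : ℝ) * p ^ a)
        (n.choose a * (a * p ^ (a - 1))) p := (hasDerivAt_pow a p).const_mul _
    refine ((h2.mul h1).add (ih (by omega))).congr_deriv ?_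
    have h3 : ((n.choose (a + 1) : ℕ) : ℝ) * (a + 1) = n.choose a * ((n - a : ℕ) : ℝ) := by
      exact_mod_cast Nat.choose_succ_right_eq n a
    rw [Nat.add_sub_cancel, ← Nat.sub_sub]
    push_cast
    linear_combination (p ^ a * (1 - p) ^ (n - a - 1)) * h3

theorem sum_choose_le (n : ℕ) (s : Finset ℕ) (hs : s ⊆ Finset.range (n + 1)) :
    ∑ i ∈ s, (n.choose i : ℝ) ≤ 2 ^ n := by
  have h : ∑ i ∈ Finset.range (n + 1), (n.choose i : ℝ) = 2 ^ n := by
    exact_mod_cast Nat.sum_range_choose n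
  rw [← h]
  exact Finset.sum_le_sum_of_subset_of_nonneg hs fun _ _ _ => by positivity

theorem upperTail_le {n a : ℕ} {p : ℝ} (hp0 : 0 ≤ p) (hp : p ≤ 1 / 2) :
    upperTail n a p ≤ p ^ a * (1 - p) ^ (n - a) * 2 ^ n := by
  have h : ∀ i ∈ Finset.Icc a n, (n.choose i : ℝ) * p ^ i * (1 - p) ^ (n - i) ≤
      p ^ a * (1 - p) ^ (n - a) * n.choose i := by
    intro i hi
    rw [Finset.mem_Icc] at hi
    obtain ⟨d, rfl⟩ := Nat.exists_eq_add_of_le hi.1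
    rw [show n - a = n - (a + d) + d by omega, pow_add, pow_add]
    have h1 : p ^ d ≤ (1 - p) ^ d := pow_le_pow_left₀ hp0 (by linarith) d
    have h2 : 0 ≤ n.choose (a + d) * p ^ a * (1 - p) ^ (n - (a + d)) := by
      have : 0 ≤ 1 - p := by linarith
      positivity
    nlinarith [mul_le_mul_of_nonneg_left h1 h2]
  refine (Finset.sum_le_sum h).trans ?_
  rw [← Finset.mul_sum]
  refine mul_le_mul_of_nonneg_left (sum_choose_le n _ ?_) ?_
  · intro i hi; rw [Finset.mem_Icc] at hi; rw [Finset.mem_range]; omega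
  · have : 0 ≤ 1 - p := by linarith
    positivity

theorem one_sub_upperTail {n a : ℕ} (han : a ≤ n) (p : ℝ) :
    1 - upperTail n a p =
      ∑ i ∈ Finset.range a, (n.choose i : ℝ) * p ^ i * (1 - p) ^ (n - i) := by
  have h := add_pow p (1 - p) n
  rw [add_sub_cancel, one_pow, Finset.sum_congr rfl fun i _ =>
    show p ^ i * (1 - p) ^ (n - i) * (n.choose i : ℝ) =
      n.choose i * p ^ i * (1 - p) ^ (n - i) by ring, Finset.range_eq_Ico,
    ← Finset.sum_Ico_consecutive _ (Nat.zero_le a) (show a ≤ n + 1 by omega)] at h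
  rw [upperTail, Finset.range_eq_Ico, show Finset.Icc a n = Finset.Ico a (n + 1) by
    ext; simp only [Finset.mem_Icc, Finset.mem_Ico]; omega]
  linarith

theorem one_sub_upperTail_le {n a : ℕ} (ha : 1 ≤ a) (han : a ≤ n) {p : ℝ} (hp : 1 / 2 ≤ p)
    (hp1 : p ≤ 1) : 1 - upperTail n a p ≤ p ^ (a - 1) * (1 - p) ^ (n - a + 1) * 2 ^ n := by
  have hq : 0 ≤ 1 - p := by linarith
  have hp0 : 0 ≤ p := by linarith
  have h : ∀ i ∈ Finset.range a, (n.choose i : ℝ) * p ^ i * (1 - p) ^ (n - i) ≤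
      p ^ (a - 1) * (1 - p) ^ (n - a + 1) * n.choose i := by
    intro i hi
    rw [Finset.mem_range] at hi
    obtain ⟨d, hd⟩ := Nat.exists_eq_add_of_le (show i ≤ a - 1 by omega)
    rw [show n - i = n - a + 1 + d by omega, hd, pow_add _ i, pow_add _ (n - a + 1)]
    have h1 : (1 - p) ^ d ≤ p ^ d := pow_le_pow_left₀ hq (by linarith) d
    have h2 : 0 ≤ n.choose i * p ^ i * (1 - p) ^ (n - a + 1) := by positivity
    nlinarith [mul_le_mul_of_nonneg_left h1 h2]
  rw [one_sub_upperTail han]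
  refine (Finset.sum_le_sum h).trans ?_
  rw [← Finset.mul_sum]
  refine mul_le_mul_of_nonneg_left (sum_choose_le n _ ?_) (by positivity)
  intro i hi; rw [Finset.mem_range] at hi ⊢; omega

/-- Lower bound on the derivative of a binomial tail in terms of the tail itself. -/
theorem upperTail_deriv_ge {n a : ℕ} (ha : 1 ≤ a) (han : a ≤ n) {p : ℝ} (hp0 : 0 ≤ p)
    (hp1 : p ≤ 1) :
    2 * a * n.choose a / 2 ^ n * min (upperTail n a p) (1 - upperTail n a p) ≤
      a * n.choose a * p ^ (a - 1) * (1 - p) ^ (n - a) := by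
  have hq : 0 ≤ 1 - p := by linarith
  have hC : 0 ≤ 2 * (a : ℝ) * n.choose a / 2 ^ n := by positivity
  have h2n : (0 : ℝ) < 2 ^ n := by positivity
  rcases le_total p (1 / 2) with h | h
  · refine (mul_le_mul_of_nonneg_left ((min_le_left _ _).trans (upperTail_le hp0 h)) hC).trans ?_
    have e : 2 * (a : ℝ) * n.choose a / 2 ^ n * (p ^ a * (1 - p) ^ (n - a) * 2 ^ n) =
        2 * p * (a * n.choose a * p ^ (a - 1) * (1 - p) ^ (n - a)) := by
      obtain ⟨b, rfl⟩ := Nat.exists_eq_add_of_le' ha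
      rw [Nat.add_sub_cancel, pow_succ]
      field_simp
    rw [e]
    exact mul_le_of_le_one_left (by positivity) (by linarith)
  · refine (mul_le_mul_of_nonneg_left
      ((min_le_right _ _).trans (one_sub_upperTail_le ha han h hp1)) hC).trans ?_
    have e : 2 * (a : ℝ) * n.choose a / 2 ^ n * (p ^ (a - 1) * (1 - p) ^ (n - a + 1) * 2 ^ n) =
        2 * (1 - p) * (a * n.choose a * p ^ (a - 1) * (1 - p) ^ (n - a)) := by
      rw [pow_succ]
      field_simp
    rw [e]
    exact mul_le_of_le_one_left (by positivity) (by linarith)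

theorem upperTail_monotoneOn {n a : ℕ} (ha : 1 ≤ a) (han : a ≤ n) :
    MonotoneOn (upperTail n a) (Set.Icc 0 1) := by
  refine monotoneOn_of_deriv_nonneg (convex_Icc 0 1)
    (fun x _ => (hasDerivAt_upperTail ha (by omega) x).continuousAt.continuousWithinAt)
    (fun x _ => (hasDerivAt_upperTail ha (by omega) x).differentiableAt.differentiableWithinAt) ?_
  intro x hx
  rw [interior_Icc] at hx
  rw [(hasDerivAt_upperTail ha (by omega) x).deriv]
  have h1 := hx.1
  have h2 : 0 < 1 - x := by linarith [hx.2]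
  positivity

theorem upperTail_sub_ge {n a : ℕ} (ha : 1 ≤ a) (han : a ≤ n) {p q : ℝ} (hp0 : 0 ≤ p)
    (hpq : p ≤ q) (hq1 : q ≤ 1) :
    2 * a * n.choose a / 2 ^ n * min (upperTail n a p) (1 - upperTail n a q) * (q - p) ≤
      upperTail n a q - upperTail n a p := by
  rcases hpq.eq_or_lt with rfl | hlt
  · simp
  obtain ⟨x, hx, he⟩ := exists_hasDerivAt_eq_slope (upperTail n a) _ hlt
    (fun x _ => (hasDerivAt_upperTail ha (by omega) x).continuousAt.continuousWithinAt)
    (fun x _ => hasDerivAt_upperTail ha (by omega) x)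
  have h1 := upperTail_deriv_ge ha han (p := x) (by linarith [hx.1]) (by linarith [hx.2])
  rw [he, le_div_iff₀ (by linarith)] at h1
  refine le_trans (mul_le_mul_of_nonneg_right ?_ (by linarith)) h1
  have mono := upperTail_monotoneOn ha han
  refine mul_le_mul_of_nonneg_left (min_le_min ?_ (sub_le_sub_left ?_ 1)) (by positivity)
  · exact mono ⟨hp0, by linarith⟩ ⟨by linarith [hx.1], by linarith [hx.2]⟩ hx.1.le
  · exact mono ⟨by linarith [hx.1], by linarith [hx.2]⟩ ⟨by linarith, hq1⟩ hx.2.le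

theorem tail_rate_sq_ge {n : ℕ} (hn : 1 ≤ n) :
    (n : ℝ) / 4 ≤ (2 * ((n + 1) / 2 : ℕ) * n.choose ((n + 1) / 2) / 2 ^ n : ℝ) ^ 2 := by
  have h1 := choose_half_sq_lower n
  have h2 : n.choose ((n + 1) / 2) = n.choose (n / 2) := by
    apply Nat.choose_symm_of_eq_add; omega
  have h3 : (n : ℝ) ≤ 2 * ((n + 1) / 2 : ℕ) := by
    exact_mod_cast (show n ≤ 2 * ((n + 1) / 2) by omega)
  have hn' : (1 : ℝ) ≤ n := by exact_mod_cast hn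
  rw [h2, div_pow, le_div_iff₀ (by positivity), ← pow_mul, mul_comm n 2, pow_mul]
  norm_num
  calc (n : ℝ) / 4 * 4 ^ n ≤ n / 4 * ((2 * n + 2) * (n.choose (n / 2) : ℝ) ^ 2) := by gcongr
    _ = (n * (n + 1) / 2) * (n.choose (n / 2) : ℝ) ^ 2 := by ring
    _ ≤ (n : ℝ) ^ 2 * (n.choose (n / 2) : ℝ) ^ 2 := by gcongr; nlinarith
    _ ≤ (2 * ((n + 1) / 2 : ℕ)) ^ 2 * (n.choose (n / 2) : ℝ) ^ 2 := by gcongr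
    _ = _ := by ring

/-- The bias parameter is a Lipschitz function of the tail, relative to the mass of the two
tails. -/
theorem abs_sub_le_of_binTail {n : ℕ} {K r e0 e1 : ℝ} (hn : 1 ≤ n) (hK : 0 < K)
    (hKn : K ^ 2 ≤ n) (hr : 0 ≤ r) (he0 : e0 ∈ Set.Icc (-1 : ℝ) 1) (he1 : e1 ∈ Set.Icc (-1 : ℝ) 1)
    (h0 : 0 < binTail n e0 0) (h1 : binTail n e1 0 < 1) (h01 : binTail n e0 0 ≤ binTail n e1 0)
    (hd : binTail n e1 0 - binTail n e0 0 ≤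
      r * min (binTail n e0 0) (1 - binTail n e1 0)) :
    |e1 - e0| ≤ 4 * r / K := by
  simp only [binTail_eq_upperTail] at *
  set a := (n + 1) / 2 with ha
  set R : ℝ := 2 * a * n.choose a / 2 ^ n with hR
  have ha1 : 1 ≤ a := by omega
  have han : a ≤ n := by omega
  have hRK : K / 2 ≤ R := by
    apply le_of_sq_le_sq _ (by positivity)
    have := tail_rate_sq_ge hn
    rw [← ha, ← hR] at this
    rw [div_pow]; linarith
  obtain ⟨h0a, h0b⟩ := he0
  obtain ⟨h1a, h1b⟩ := he1
  rw [le_div_iff₀ hK]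
  rcases le_total e0 e1 with h | h
  · have h2 := upperTail_sub_ge ha1 han (p := (1 + e0) / 2) (q := (1 + e1) / 2) (by linarith)
      (by linarith) (by linarith)
    rw [← hR] at h2
    have hm : 0 < min (upperTail n a ((1 + e0) / 2)) (1 - upperTail n a ((1 + e1) / 2)) :=
      lt_min h0 (by linarith)
    set M := min (upperTail n a ((1 + e0) / 2)) (1 - upperTail n a ((1 + e1) / 2))
    rw [abs_of_nonneg (by linarith)]
    have h3 : M * (R * ((e1 - e0) / 2)) ≤ M * r := by
      refine le_trans (le_of_eq ?_) ((h2.trans hd).trans_eq (by ring)); ring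
    have h4 := le_of_mul_le_mul_left h3 hm
    nlinarith [mul_le_mul_of_nonneg_right hRK (show 0 ≤ (e1 - e0) / 2 by linarith)]
  · have h2 := upperTail_sub_ge ha1 han (p := (1 + e1) / 2) (q := (1 + e0) / 2) (by linarith)
      (by linarith) (by linarith)
    rw [← hR] at h2
    have hm : 0 < min (upperTail n a ((1 + e1) / 2)) (1 - upperTail n a ((1 + e0) / 2)) :=
      lt_min (by linarith) (by linarith)
    set M := min (upperTail n a ((1 + e1) / 2)) (1 - upperTail n a ((1 + e0) / 2))
    rw [abs_of_nonpos (by linarith)]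
    have h3 : M * (R * ((e0 - e1) / 2)) ≤ M * 0 := by
      refine le_trans (le_of_eq ?_) (h2.trans (by linarith)); ring
    have h4 := le_of_mul_le_mul_left h3 hm
    nlinarith [mul_le_mul_of_nonneg_right hRK (show 0 ≤ (e0 - e1) / 2 by linarith)]

theorem binPMF_zero_neg (n : ℕ) (k : ℤ) : binPMF n 0 (-k) = binPMF n 0 k := by
  have h1 := binTail_step n 0 k
  have h2 := binTail_step n 0 (-k)
  have h3 := one_sub_binTail_zero n k
  have h4 := one_sub_binTail_zero n (k + 1)
  rw [show 1 - (k + 1) = -k by ring] at h4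
  rw [show 1 - k = -k + 1 by ring] at h3
  linarith

theorem binTail_zero_pos {n : ℕ} {k : ℤ} (h : k ≤ n) : 0 < binTail n 0 k := by
  refine lt_of_lt_of_le ?_ (binTail_zero_anti n h)
  rw [binTail_step]
  have h1 := binPMF_zero_eq n n
  rw [show (2 * n - n : ℤ) = n by ring, Nat.choose_self] at h1
  have h2 := binTail_zero_nonneg n (n + 1)
  rw [h1]
  positivity

theorem binPMF_le_tail {s n : ℕ} {l : ℝ} (hl : 1 ≤ l) (hn : 80 * l ≤ n) (hs : n ^ 2 ≤ 4 * s)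
    {k : ℤ} (hk : |(k : ℝ)| ≤ 3 * l * n) :
    binPMF s 0 k ≤ 320 * l / n * binTail s 0 (k + 1) := by
  have hn0 : (0 : ℝ) < n := by linarith
  have hs' : (n : ℝ) ^ 2 ≤ 4 * s := by exact_mod_cast hs
  have hJ1 : (1 : ℝ) ≤ n / (80 * l) := by rw [le_div_iff₀ (by positivity)]; linarith
  have hJ2 : (⌊(n : ℝ) / (80 * l)⌋₊ : ℝ) ≤ n / (80 * l) := Nat.floor_le (by positivity)
  have hJ3 : (n : ℝ) / (160 * l) ≤ ⌊(n : ℝ) / (80 * l)⌋₊ := by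
    have h := Nat.lt_floor_add_one ((n : ℝ) / (80 * l))
    have h' : (1 : ℝ) ≤ ⌊(n : ℝ) / (80 * l)⌋₊ := by
      exact_mod_cast (Nat.one_le_floor_iff _).2 hJ1
    have e : (n : ℝ) / (160 * l) = n / (80 * l) / 2 := by field_simp; norm_num
    linarith
  set J := ⌊(n : ℝ) / (80 * l)⌋₊
  have hB1 : (⌊4 * l * n⌋ : ℝ) ≤ 4 * l * n := Int.floor_le _
  have hB2 : 4 * l * n < ⌊4 * l * n⌋ + 1 := Int.lt_floor_add_one _
  set B := ⌊4 * l * n⌋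
  obtain ⟨hk1, hk2⟩ := abs_le.1 hk
  have hJn : (n : ℝ) / (80 * l) ≤ n / 80 := by
    apply div_le_div_of_nonneg_left hn0.le (by norm_num); linarith
  have hln : (n : ℝ) ≤ l * n := by nlinarith
  have h1 : J * binPMF s 0 k ≤ 2 * binTail s 0 (k + 1) := by
    apply binPMF_hazard (B := B)
    · have : -(s : ℝ) ≤ k := by nlinarith
      exact_mod_cast this
    · have : (k + 2 * J : ℝ) < B + 1 := by nlinarith
      have : k + 2 * J < B + 1 := by exact_mod_cast this
      omega
    · have : (0 : ℝ) < B + 1 := by nlinarith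
      have : 0 < B + 1 := by exact_mod_cast this
      omega
    · have : (4 * J * (B + 1) : ℝ) ≤ s := by
        have h2 : (B : ℝ) + 1 ≤ 5 * l * n := by nlinarith
        calc (4 * J * (B + 1) : ℝ) ≤ 4 * (n / (80 * l)) * (5 * l * n) := by
              have : (0 : ℝ) ≤ B + 1 := by nlinarith
              gcongr
          _ = n ^ 2 / 4 := by field_simp; norm_num
          _ ≤ s := by linarith
      exact_mod_cast this
    · have : (0 : ℝ) < s := by nlinarith
      exact_mod_cast this
  have hP := binPMF_zero_nonneg s k
  have h2 : (n : ℝ) / (160 * l) * binPMF s 0 k ≤ 2 * binTail s 0 (k + 1) :=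
    (mul_le_mul_of_nonneg_right hJ3 hP).trans h1
  have e : binPMF s 0 k = 160 * l / n * (n / (160 * l) * binPMF s 0 k) := by field_simp
  rw [e]
  calc _ ≤ 160 * l / n * (2 * binTail s 0 (k + 1)) := by gcongr
    _ = _ := by ring

theorem binTail_zero_mem {s : ℕ} (hs : 3 ≤ s) : 1 / 4 ≤ 1 - binTail s 0 0 ∧
    1 / 2 ≤ binTail s 0 0 := by
  have h1 := binTail_step s 0 0
  have h2 := one_sub_binTail_zero s 0
  have h3 := binPMF_zero_nonneg s 0
  have h4 := binPMF_zero_le (n := s) (x := 2) (by norm_num)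
    (by have : (3 : ℝ) ≤ s := by exact_mod_cast hs
        linarith) 0
  simp only [zero_add, sub_zero] at h1 h2
  constructor <;> linarith

section BiasParameter

variable {m n s S : ℕ} {l : ℝ} {e : ℤ → ℝ}

theorem bias_step (hl : 1 ≤ l) (hn : 80 * l ≤ n) (hnm : n ≤ m) (hs : n ^ 2 ≤ 4 * s)
    (hS : m ^ 2 ≤ 4 * S)
    (he : ∀ y, e y ∈ Set.Icc (-1 : ℝ) 1 ∧ binTail S (e y) 0 = binTail s 0 (-y))
    {y : ℤ} (hy : |(y : ℝ)| ≤ 2 * l * n) :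
    |e (y + 1) - e y| ≤ 2560 * l / (n * m) := by
  have hn0 : (0 : ℝ) < n := by linarith
  have hm0 : (0 : ℝ) < m := lt_of_lt_of_le hn0 (by exact_mod_cast hnm)
  have hS' : (m : ℝ) ^ 2 ≤ 4 * S := by exact_mod_cast hS
  have hs' : (n : ℝ) ^ 2 ≤ 4 * s := by exact_mod_cast hs
  have hln : (80 : ℝ) ≤ l * n := by nlinarith
  obtain ⟨hy1, hy2⟩ := abs_le.1 hy
  have hys1 : y + 1 < s := by
    have : (y : ℝ) + 1 < s := by nlinarith
    exact_mod_cast this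
  have hys2 : -y ≤ s := by
    have : -(y : ℝ) ≤ s := by nlinarith
    exact_mod_cast this
  have hstep := binTail_step s 0 (-(y + 1))
  rw [show -(y + 1) + 1 = -y by ring] at hstep
  have hp := binPMF_zero_nonneg s (-(y + 1))
  have hy3 : |((-(y + 1) : ℤ) : ℝ)| ≤ 3 * l * n := by
    rw [abs_le]; push_cast; constructor <;> linarith
  have hy4 : |((y + 1 : ℤ) : ℝ)| ≤ 3 * l * n := by
    rw [abs_le]; push_cast; constructor <;> linarith
  have b1 := binPMF_le_tail hl hn hs hy3
  have b2 := binPMF_le_tail hl hn hs hy4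
  rw [show -(y + 1) + 1 = -y by ring] at b1
  rw [← binPMF_zero_neg] at b2
  have h1 := one_sub_binTail_zero s (-(y + 1))
  rw [show 1 - -(y + 1) = y + 1 + 1 by ring] at h1
  rw [← h1] at b2
  have key := abs_sub_le_of_binTail (n := S) (K := m / 2) (r := 320 * l / n) (e0 := e y)
    (e1 := e (y + 1)) (by
      have : (0 : ℝ) < S := by nlinarith
      exact_mod_cast this) (by positivity) (by linarith) (by positivity) (he y).1
    (he (y + 1)).1
    (by rw [(he y).2]; exact binTail_zero_pos hys2)
    (by rw [(he (y + 1)).2]; linarith [binTail_zero_pos (n := s) (k := y + 1 + 1) (by omega)])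
    (by rw [(he y).2, (he (y + 1)).2]; linarith)
    (by
      rw [(he y).2, (he (y + 1)).2, mul_min_of_nonneg _ _ (by positivity)]
      exact le_min (by linarith) (by linarith))
  refine key.trans_eq ?_
  field_simp
  norm_num

theorem bias_lipschitz (hl : 1 ≤ l) (hn : 80 * l ≤ n) (hnm : n ≤ m) (hs : n ^ 2 ≤ 4 * s)
    (hS : m ^ 2 ≤ 4 * S)
    (he : ∀ y, e y ∈ Set.Icc (-1 : ℝ) 1 ∧ binTail S (e y) 0 = binTail s 0 (-y))
    {y z : ℤ} (hy : |(y : ℝ)| ≤ 2 * l * n) (hz : |(z : ℝ)| ≤ 2 * l * n) :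
    |e z - e y| ≤ 2560 * l / (n * m) * |(z : ℝ) - y| := by
  wlog hyz : y ≤ z generalizing y z
  · rw [abs_sub_comm, abs_sub_comm (z : ℝ)]; exact this hz hy (by omega)
  obtain ⟨d, rfl⟩ := Int.le.dest hyz
  rw [show ((y + d : ℤ) : ℝ) - y = d by push_cast; ring, Nat.abs_cast]
  clear hyz
  induction d with
  | zero => simp
  | succ d ih =>
    push_cast at hz ⊢
    obtain ⟨hz1, hz2⟩ := abs_le.1 hz
    obtain ⟨hy1, hy2⟩ := abs_le.1 hy
    have hd : |((y + d : ℤ) : ℝ)| ≤ 2 * l * n := by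
      have : (0 : ℝ) ≤ d := Nat.cast_nonneg d
      rw [abs_le]; push_cast; constructor <;> linarith
    have h1 := ih hd
    have h2 := bias_step hl hn hnm hs hS he hd
    rw [← add_assoc]
    have h3 := abs_sub_le (e (y + d + 1)) (e (y + d)) (e y)
    linarith

theorem bias_le_half (hl : 1 ≤ l) (hn : 20480 * l ^ 2 ≤ n) (hnm : n ≤ m) (hs : n ^ 2 ≤ 4 * s)
    (hS : m ^ 2 ≤ 4 * S)
    (he : ∀ y, e y ∈ Set.Icc (-1 : ℝ) 1 ∧ binTail S (e y) 0 = binTail s 0 (-y))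
    {y : ℤ} (hy : |(y : ℝ)| ≤ 2 * l * n) : |e y| ≤ 1 / 2 := by
  have hnm' : (n : ℝ) ≤ m := by exact_mod_cast hnm
  have hn1 : (20480 : ℝ) ≤ n := by nlinarith
  have hn0 : (0 : ℝ) < n := by linarith
  have hm0 : (0 : ℝ) < m := by linarith
  have hS' : (m : ℝ) ^ 2 ≤ 4 * S := by exact_mod_cast hS
  have hs' : (n : ℝ) ^ 2 ≤ 4 * s := by exact_mod_cast hs
  have hs3 : 3 ≤ s := by
    have : (3 : ℝ) ≤ s := by nlinarith
    exact_mod_cast this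
  have hS3 : 3 ≤ S := by
    have : (3 : ℝ) ≤ S := by nlinarith
    exact_mod_cast this
  obtain ⟨a1, a2⟩ := binTail_zero_mem hs3
  obtain ⟨b1, b2⟩ := binTail_zero_mem hS3
  have h0 : |e 0| ≤ 1 / 4 := by
    have hbase : 4 * (2 : ℝ) / (m / 2) ≤ 1 / 4 := by
      rw [div_le_iff₀ (by positivity)]; linarith
    refine le_trans ?_ hbase
    have hz : (0 : ℝ) ∈ Set.Icc (-1 : ℝ) 1 := by norm_num
    have e0 := (he 0).2
    rw [neg_zero] at e0
    rcases le_total (binTail S 0 0) (binTail S (e 0) 0) with h | h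
    · have := abs_sub_le_of_binTail (n := S) (K := m / 2) (r := 2) (by omega) (by positivity)
        (by linarith) (by norm_num) hz (he 0).1 (by linarith) (by linarith) h (by
          rw [mul_min_of_nonneg _ _ (by norm_num)]
          exact le_min (by linarith) (by linarith))
      simpa using this
    · have := abs_sub_le_of_binTail (n := S) (K := m / 2) (r := 2) (by omega) (by positivity)
        (by linarith) (by norm_num) (he 0).1 hz (by linarith) (by linarith) h (by
          rw [mul_min_of_nonneg _ _ (by norm_num)]
          exact le_min (by linarith) (by linarith))
      simpa using this
  have h1 := bias_lipschitz hl (by nlinarith) hnm hs hS he (y := 0) (z := y)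
    (by simp; positivity) hy
  rw [Int.cast_zero, sub_zero] at h1
  have h2 : 2560 * l / (n * m) * |(y : ℝ)| ≤ 1 / 4 := by
    calc _ ≤ 2560 * l / (n * m) * (2 * l * n) := by gcongr
      _ = 5120 * l ^ 2 / m := by field_simp; norm_num
      _ ≤ 1 / 4 := by rw [div_le_iff₀ hm0]; linarith
  have h3 := abs_sub_abs_le_abs_sub (e y) (e 0)
  linarith

end BiasParameter

theorem fairExp_sum {ι : Type*} (n : ℕ) (s : Finset ι) (f : ι → ℤ → ℝ) :
    fairExp n (fun z => ∑ i ∈ s, f i z) = ∑ i ∈ s, fairExp n (f i) := by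
  simp only [← sum_binPMF_zero_mul, Finset.mul_sum]
  exact Finset.sum_comm

theorem fairExp_sub (n : ℕ) (f g : ℤ → ℝ) :
    fairExp n (fun z => f z - g z) = fairExp n f - fairExp n g := by
  have h := fairExp_add n f (fun z => -1 * g z)
  rw [fairExp_mul_left] at h
  rw [sub_eq_add_neg, ← neg_one_mul, ← h]
  congr 1; ext z; ring

theorem abs_fairExp_le (n : ℕ) {f g : ℤ → ℝ} (h : ∀ z : ℤ, |z| ≤ n → |f z| ≤ g z) :
    |fairExp n f| ≤ fairExp n g := by
  rw [abs_le]
  refine ⟨?_, fairExp_mono n fun z hz => (abs_le.1 (h z hz)).2⟩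
  have := fairExp_mono n (f := fun z => -1 * g z) (g := f)
    fun z hz => by linarith [(abs_le.1 (h z hz)).1]
  rw [fairExp_mul_left] at this
  linarith

theorem abs_exp_sub_one_le_of_bounds {w a x : ℝ} (hx : 0 ≤ a * x)
    (h1 : Real.exp (-(a * x)) ≤ w) (h2 : w ≤ Real.exp (a * x)) :
    |w - 1| ≤ a * x * Real.exp (a * x) := by
  have h3 := Real.add_one_le_exp (-(a * x))
  have h4 := Real.one_le_exp hx
  rw [abs_le]
  constructor
  · nlinarith
  · have e : Real.exp (-(a * x)) * Real.exp (a * x) = 1 := by rw [← Real.exp_add]; simp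
    have := mul_le_mul_of_nonneg_right h3 (Real.exp_pos (a * x)).le
    rw [e] at this
    linarith

/-- Reweighting a fair binomial by a likelihood close to `1` changes the mean of a Lipschitz
function only slightly. -/
theorem reweighted_sub_le {n : ℕ} (hn : 1 ≤ n) {W V : ℤ → ℝ} {a b w v : ℝ} (ha : 0 ≤ a)
    (hb : 0 ≤ b) (hw : 0 < w) (han : 64 * a ^ 2 * n ≤ 1)
    (hW1 : ∀ z : ℤ, |z| ≤ n → w * Real.exp (-(a * |(z : ℝ)|)) ≤ W z)
    (hW2 : ∀ z : ℤ, |z| ≤ n → W z ≤ w * Real.exp (a * |(z : ℝ)|))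
    (hV : ∀ z : ℤ, |z| ≤ n → |V z - v| ≤ b * |(z : ℝ)|) :
    |fairExp n (fun z => W z * V z) / fairExp n W - fairExp n V| ≤ 64 * a * b * n := by
  have hn0 : (0 : ℝ) < n := by exact_mod_cast hn
  set q := Real.sqrt n with hq
  have hq0 : 0 < q := Real.sqrt_pos.2 hn0
  have hqq : q ^ 2 = n := Real.sq_sqrt hn0.le
  have haq : a * q ≤ 1 / 8 := by
    apply le_of_sq_le_sq _ (by norm_num)
    rw [mul_pow, hqq]; linarith
  have hmgf := fairExp_exp_abs_le (n := n) (t := 1 / q) (by rw [div_pow, hqq]; field_simp; simp)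
  have habs : fairExp n (fun z => |(z : ℝ)|) ≤ 4 * q := by
    have : fairExp n (fun z => |(z : ℝ)|) ≤
        fairExp n (fun z => q * Real.exp (1 / q * |(z : ℝ)|)) := by
      refine fairExp_mono n fun z _ => ?_
      have h1 := Real.add_one_le_exp (1 / q * |(z : ℝ)|)
      have e : |(z : ℝ)| = q * (1 / q * |(z : ℝ)|) := by field_simp
      nlinarith
    rw [fairExp_mul_left] at this
    nlinarith
  have hWbar : w / 2 ≤ fairExp n W := by
    have h1 : fairExp n (fun z => w + -(w * a) * |(z : ℝ)|) ≤ fairExp n W := by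
      refine fairExp_mono n fun z hz => le_trans ?_ (hW1 z hz)
      nlinarith [Real.add_one_le_exp (-(a * |(z : ℝ)|))]
    rw [fairExp_add, fairExp_mul_left, fairExp_const] at h1
    have h2 : w * a * fairExp n (fun z => |(z : ℝ)|) ≤ w * a * (4 * q) := by gcongr
    nlinarith
  set Vb := fairExp n V with hVb
  have hVbar : |Vb - v| ≤ 4 * q * b := by
    have h1 := abs_fairExp_le n hV
    rw [fairExp_sub, fairExp_const, fairExp_mul_left] at h1
    nlinarith
  have hnum : |fairExp n (fun z => W z * V z) - fairExp n W * Vb| ≤ 32 * w * a * b * n := by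
    have e : fairExp n (fun z => W z * V z) - fairExp n W * Vb =
        fairExp n (fun z => (W z - w) * (V z - Vb)) := by
      have e1 : (fun z => (W z - w) * (V z - Vb)) =
          fun z => (W z * V z - Vb * W z) - w * (V z - Vb) := by ext z; ring
      rw [e1, fairExp_sub, fairExp_sub, fairExp_mul_left, fairExp_mul_left, fairExp_sub,
        fairExp_const, ← hVb]
      ring
    rw [e]
    refine (abs_fairExp_le n (g := fun z => (8 * w * a * b * n) *
      Real.exp (1 / q * |(z : ℝ)|)) fun z hz => ?_).trans ?_
    · have hz0 : 0 ≤ |(z : ℝ)| := abs_nonneg _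
      set x := |(z : ℝ)| with hx
      have f1 : |W z - w| ≤ w * (a * x * Real.exp (a * x)) := by
        have h1 := abs_exp_sub_one_le_of_bounds (w := W z / w) (a := a) (x := x) (by positivity)
          (by rw [le_div_iff₀ hw, mul_comm]; exact hW1 z hz)
          (by rw [div_le_iff₀ hw, mul_comm]; exact hW2 z hz)
        have e2 : W z - w = w * (W z / w - 1) := by field_simp
        rw [e2, abs_mul, abs_of_pos hw]
        gcongr
      have f2 : |V z - Vb| ≤ b * (x + 4 * q) := by
        have h1 := abs_sub_le (V z) v Vb
        rw [abs_sub_comm v] at h1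
        have h2 := hV z hz
        linarith
      rw [abs_mul]
      set u := 1 / q * x with hu
      have hu0 : 0 ≤ u := by positivity
      have hxu : x = q * u := by rw [hu]; field_simp
      have f3 : Real.exp (a * x) ≤ Real.exp (u / 2) := by
        apply Real.exp_le_exp.2
        rw [hxu]; nlinarith
      have f4 : u ^ 2 + 4 * u ≤ 8 * Real.exp (u / 2) := by
        have := Real.quadratic_le_exp_of_nonneg (x := u / 2) (by positivity)
        nlinarith
      have f5 : Real.exp (u / 2) * Real.exp (u / 2) = Real.exp u := by
        rw [← Real.exp_add]; ring_nf
      calc _ ≤ w * (a * x * Real.exp (a * x)) * (b * (x + 4 * q)) := by gcongr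
        _ ≤ w * (a * x * Real.exp (u / 2)) * (b * (x + 4 * q)) := by gcongr
        _ = w * a * b * n * ((u ^ 2 + 4 * u) * Real.exp (u / 2)) := by
            rw [hxu, ← hqq]; ring
        _ ≤ w * a * b * n * (8 * Real.exp (u / 2) * Real.exp (u / 2)) := by gcongr
        _ = 8 * w * a * b * n * Real.exp u := by rw [mul_assoc 8, f5]; ring
    · rw [fairExp_mul_left]
      have : 0 ≤ 8 * w * a * b * n := by positivity
      nlinarith
  have hWpos : 0 < fairExp n W := by linarith
  have e : fairExp n (fun z => W z * V z) / fairExp n W - Vb =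
      (fairExp n (fun z => W z * V z) - fairExp n W * Vb) / fairExp n W := by
    field_simp
  rw [e, abs_div, abs_of_pos hWpos, div_le_iff₀ hWpos]
  refine hnum.trans ?_
  have : 0 ≤ 64 * a * b * n := by positivity
  nlinarith

/-- Probability of a vector of independent `Ber(e)` entries. -/
noncomputable def vecProb {N : ℕ} (e : ℝ) (v : Fin N → Bool) : ℝ :=
  ∏ j : Fin N, (if v j then (1 + e) / 2 else (1 - e) / 2)

/-- Sum of the entries of a sign vector. -/
def vecSum {N : ℕ} (v : Fin N → Bool) : ℝ := ∑ j, (if v j then 1 else -1)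

theorem vecProb_nonneg {N : ℕ} {e : ℝ} (he : |e| ≤ 1) (v : Fin N → Bool) : 0 ≤ vecProb e v := by
  obtain ⟨h1, h2⟩ := abs_le.1 he
  exact Finset.prod_nonneg fun j _ => by split_ifs <;> linarith

theorem sum_prod_bool (N : ℕ) (f : Bool → ℝ) :
    ∑ v : Fin N → Bool, ∏ j, f (v j) = (f true + f false) ^ N := by
  have h := Finset.prod_univ_sum (fun _ : Fin N => (Finset.univ : Finset Bool)) (fun _ b => f b)
  rw [Fintype.piFinset_univ] at h
  rw [← h]
  simp

theorem sum_vecProb (N : ℕ) (e : ℝ) : ∑ v : Fin N → Bool, vecProb e v = 1 := by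
  have h := sum_prod_bool N (fun b => if b then (1 + e) / 2 else (1 - e) / 2)
  simp only [vecProb]
  rw [h]
  simp only [if_true, Bool.false_eq_true, if_false]
  rw [show (1 + e) / 2 + (1 - e) / 2 = 1 by ring, one_pow]

theorem vecProb_mgf {N : ℕ} {e t : ℝ} (he : |e| ≤ 1) (ht : |t| ≤ 1 / 2) :
    ∑ v : Fin N → Bool, vecProb e v * Real.exp (t * (vecSum v - N * e)) ≤
      Real.exp (N * t ^ 2) := by
  have h := sum_prod_bool N (fun b => (if b then (1 + e) / 2 else (1 - e) / 2) *
    Real.exp (t * ((if b then 1 else -1) - e)))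
  have h1 : ∀ v : Fin N → Bool, vecProb e v * Real.exp (t * (vecSum v - N * e)) =
      ∏ j, ((if v j then (1 + e) / 2 else (1 - e) / 2) *
        Real.exp (t * ((if v j then 1 else -1) - e))) := by
    intro v
    rw [Finset.prod_mul_distrib, ← Real.exp_sum, ← Finset.mul_sum, Finset.sum_sub_distrib]
    simp [vecProb, vecSum]
  simp only [h1]
  rw [h, Real.exp_nat_mul]
  obtain ⟨e1, e2⟩ := abs_le.1 he
  have bound : ∀ x : ℝ, |x| ≤ 2 → Real.exp (t * x) ≤ 1 + t * x + t ^ 2 * x ^ 2 := by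
    intro x hx
    have h2 : |t * x| ≤ 1 := by
      rw [abs_mul]
      nlinarith [abs_nonneg t, abs_nonneg x]
    have h3 := (abs_le.1 (Real.abs_exp_sub_one_sub_id_le h2)).2
    rw [mul_pow] at h3
    linarith
  have b1 := bound (1 - e) (by rw [abs_le]; constructor <;> linarith)
  have b2 := bound (-1 - e) (by rw [abs_le]; constructor <;> linarith)
  simp only [if_true, Bool.false_eq_true, if_false]
  refine pow_le_pow_left₀ ?_ ?_ N
  · have : 0 ≤ (1 + e) / 2 := by linarith
    have : 0 ≤ (1 - e) / 2 := by linarith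
    positivity
  · have c1 := mul_le_mul_of_nonneg_left b1 (show 0 ≤ (1 + e) / 2 by linarith)
    have c2 := mul_le_mul_of_nonneg_left b2 (show 0 ≤ (1 - e) / 2 by linarith)
    have c3 := Real.add_one_le_exp (t ^ 2)
    nlinarith [mul_nonneg (sq_nonneg t) (sq_nonneg e)]

theorem vecProb_tail {N : ℕ} {e u : ℝ} (he : |e| ≤ 1) (hu : 0 ≤ u) (huN : u ≤ N) (hN : 1 ≤ N) :
    ∑ v : Fin N → Bool, vecProb e v * (if u ≤ |vecSum v - N * e| then 1 else 0) ≤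
      2 * Real.exp (-(u ^ 2 / (4 * N))) := by
  have hN0 : (0 : ℝ) < N := by exact_mod_cast hN
  set t := u / (2 * N) with ht
  have ht0 : 0 ≤ t := by positivity
  have ht1 : t ≤ 1 / 2 := by rw [ht, div_le_iff₀ (by positivity)]; linarith
  have m1 := vecProb_mgf (N := N) (t := t) he (by rwa [abs_of_nonneg ht0])
  have m2 := vecProb_mgf (N := N) (t := -t) he (by rwa [abs_neg, abs_of_nonneg ht0])
  rw [neg_sq] at m2
  have h1 : ∀ v : Fin N → Bool,
      vecProb e v * (if u ≤ |vecSum v - N * e| then (1 : ℝ) else 0) ≤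
      Real.exp (-(t * u)) * (vecProb e v * Real.exp (t * (vecSum v - N * e)) +
        vecProb e v * Real.exp (-t * (vecSum v - N * e))) := by
    intro v
    rw [← mul_add, mul_left_comm]
    refine mul_le_mul_of_nonneg_left ?_ (vecProb_nonneg he v)
    rw [mul_add, ← Real.exp_add, ← Real.exp_add]
    have p1 := Real.exp_pos (-(t * u) + t * (vecSum v - N * e))
    have p2 := Real.exp_pos (-(t * u) + -t * (vecSum v - N * e))
    split_ifs with h
    · rcases le_abs.1 h with h | h
      · have := Real.one_le_exp (x := -(t * u) + t * (vecSum v - N * e)) (by nlinarith)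
        linarith
      · have := Real.one_le_exp (x := -(t * u) + -t * (vecSum v - N * e)) (by nlinarith)
        linarith
    · linarith
  refine (Finset.sum_le_sum fun v _ => h1 v).trans ?_
  rw [← Finset.mul_sum, Finset.sum_add_distrib]
  have e1 : -(u ^ 2 / (4 * N)) = -(t * u) + N * t ^ 2 := by rw [ht]; field_simp; ring
  rw [e1, Real.exp_add]
  nlinarith [Real.exp_pos (-(t * u))]

theorem vecProb_ratio_le {N : ℕ} {e0 e1 : ℝ} (h0 : |e0| ≤ 1 / 2) (h1 : |e1| ≤ 1 / 2)
    (v : Fin N → Bool) :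
    vecProb e1 v ≤ vecProb e0 v *
      Real.exp ((e1 - e0) * (vecSum v - N * e0) / (1 - e0 ^ 2)) := by
  obtain ⟨a1, a2⟩ := abs_le.1 h0
  obtain ⟨b1, b2⟩ := abs_le.1 h1
  have hd : 0 < 1 - e0 ^ 2 := by nlinarith
  have e : (e1 - e0) * (vecSum v - N * e0) / (1 - e0 ^ 2) =
      ∑ j : Fin N, (e1 - e0) * ((if v j then 1 else -1) - e0) / (1 - e0 ^ 2) := by
    rw [← Finset.sum_div, ← Finset.mul_sum, Finset.sum_sub_distrib]
    simp [vecSum]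
  rw [e, Real.exp_sum, vecProb, vecProb, ← Finset.prod_mul_distrib]
  refine Finset.prod_le_prod (fun j _ => by split_ifs <;> linarith) fun j _ => ?_
  split_ifs
  · have h := Real.add_one_le_exp ((e1 - e0) * (1 - e0) / (1 - e0 ^ 2))
    refine le_trans (le_of_eq ?_) (mul_le_mul_of_nonneg_left h (by linarith))
    have : 1 - e0 ^ 2 = (1 - e0) * (1 + e0) := by ring
    have n1 : (1 - e0) ≠ 0 := by linarith
    have n2 : (1 + e0) ≠ 0 := by linarith
    rw [this]; field_simp; ring
  · have h := Real.add_one_le_exp ((e1 - e0) * (-1 - e0) / (1 - e0 ^ 2))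
    refine le_trans (le_of_eq ?_) (mul_le_mul_of_nonneg_left h (by linarith))
    have : 1 - e0 ^ 2 = (1 - e0) * (1 + e0) := by ring
    have n1 : (1 - e0) ≠ 0 := by linarith
    have n2 : (1 + e0) ≠ 0 := by linarith
    rw [this]; field_simp; ring

theorem abs_binTail_zero_sub_le {s : ℕ} {x : ℝ} (hx : 0 < x) (hs : x ^ 2 ≤ s + 1) (j k : ℤ) :
    |binTail s 0 j - binTail s 0 k| ≤ 1 / x * |(j : ℝ) - k| := by
  have h : ∀ (d : ℕ) (k : ℤ), |binTail s 0 (k + d) - binTail s 0 k| ≤ 1 / x * d := by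
    intro d
    induction d with
    | zero => intro k; simp
    | succ d ih =>
      intro k
      have h1 := ih k
      have h2 := binTail_step s 0 (k + d)
      have h3 := binPMF_zero_le hx hs (k + d)
      have h4 := binPMF_zero_nonneg s (k + d)
      have e : k + ((d + 1 : ℕ) : ℤ) = k + d + 1 := by push_cast; ring
      rw [e]
      push_cast
      rw [abs_le] at h1 ⊢
      constructor <;> linarith [h1.1, h1.2]
  rcases le_total k j with hkj | hkj
  · obtain ⟨d, rfl⟩ := Int.le.dest hkj
    refine (h d k).trans (le_of_eq ?_)
    push_cast
    rw [add_sub_cancel_left, abs_of_nonneg (by positivity)]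
  · obtain ⟨d, rfl⟩ := Int.le.dest hkj
    rw [abs_sub_comm, abs_sub_comm (j : ℝ)]
    refine (h d j).trans (le_of_eq ?_)
    push_cast
    rw [add_sub_cancel_left, abs_of_nonneg (by positivity)]

theorem vecProb_pos {N : ℕ} {e : ℝ} (he : |e| < 1) (v : Fin N → Bool) : 0 < vecProb e v := by
  obtain ⟨h1, h2⟩ := abs_lt.1 he
  exact Finset.prod_pos fun j _ => by split_ifs <;> linarith

theorem abs_mul_div_one_sub_sq_le {d t e D U : ℝ} (hd : |d| ≤ D) (ht : |t| ≤ U)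
    (he : |e| ≤ 1 / 2) : |d * t / (1 - e ^ 2)| ≤ 2 * D * U := by
  obtain ⟨a1, a2⟩ := abs_le.1 he
  have hpos : 1 / 2 ≤ 1 - e ^ 2 := by nlinarith
  have hU : 0 ≤ U := (abs_nonneg _).trans ht
  have hD : 0 ≤ D := (abs_nonneg _).trans hd
  rw [abs_div, abs_mul, abs_of_pos (by linarith : 0 < 1 - e ^ 2), div_le_iff₀ (by linarith)]
  have h1 : |d| * |t| ≤ D * U := by gcongr
  have h2 : 0 ≤ D * U := by positivity
  nlinarith

theorem sqrt_vector_length_le {c S m : ℕ} (hc : 1 ≤ c) (hS : S ≤ m ^ 2) :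
    Real.sqrt ((c * S : ℕ) : ℝ) ≤ c * m := by
  rw [Real.sqrt_le_left (by positivity)]
  have : c * S ≤ (c * m) ^ 2 := by
    rw [mul_pow]; exact Nat.mul_le_mul (Nat.le_self_pow (by norm_num) c) hS
  exact_mod_cast this

section
variable {n m s S c : ℕ} {l : ℝ} {e : ℤ → ℝ} {y : ℤ}

/-- Constant governing the influence of a hint made of `c` vectors. -/
noncomputable def hintConst (c : ℕ) : ℝ := 5120 * (2 + 5120 * c) * c

theorem le_hintConst (hc : 1 ≤ c) : 20480 ≤ hintConst c := by
  have : (1 : ℝ) ≤ c := by exact_mod_cast hc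
  unfold hintConst
  nlinarith

theorem le_of_hintConst_le (hl : 1 ≤ l) (hc : 1 ≤ c) (hn : 64 * hintConst c ^ 2 * l ^ 4 ≤ n) :
    20480 * l ^ 2 ≤ n := by
  have hA := le_hintConst hc
  refine le_trans ?_ hn
  have h1 : 20480 ≤ 64 * hintConst c ^ 2 := by nlinarith
  have h2 : l ^ 2 ≤ l ^ 4 := pow_le_pow_right₀ hl (by norm_num)
  exact mul_le_mul h1 h2 (by positivity) (by positivity)

theorem shifted_abs_le (hl : 1 ≤ l) (hy : |(y : ℝ)| ≤ l * n) {z : ℤ} (hz : |z| ≤ n) :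
    |((y + z : ℤ) : ℝ)| ≤ 2 * l * n := by
  have h1 : |(z : ℝ)| ≤ n := by exact_mod_cast hz
  have h2 : (n : ℝ) ≤ l * n := le_mul_of_one_le_left (by positivity) hl
  push_cast
  linarith [abs_add_le (y : ℝ) z]

theorem shifted_bias_sub_le (hl : 1 ≤ l) (hc : 1 ≤ c)
    (hnm : n ≤ m) (hs : n ^ 2 ≤ 4 * s) (hS : m ^ 2 ≤ 4 * S)
    (he : ∀ y, e y ∈ Set.Icc (-1 : ℝ) 1 ∧ binTail S (e y) 0 = binTail s 0 (-y))
    (hn : 64 * hintConst c ^ 2 * l ^ 4 ≤ n) (hy : |(y : ℝ)| ≤ l * n) {z : ℤ} (hz : |z| ≤ n) :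
    |e (y + z) - e y| ≤ 2560 * l / (n * m) * |(z : ℝ)| := by
  have hn2 := le_of_hintConst_le hl hc hn
  have h := bias_lipschitz (y := y) (z := y + z) hl (by nlinarith) hnm hs hS he
    (by have : 0 ≤ l * n := by positivity
        linarith) (shifted_abs_le hl hy hz)
  push_cast at h
  rwa [add_sub_cancel_left] at h

theorem shifted_bias_le_half (hl : 1 ≤ l) (hc : 1 ≤ c)
    (hnm : n ≤ m) (hs : n ^ 2 ≤ 4 * s) (hS : m ^ 2 ≤ 4 * S)
    (he : ∀ y, e y ∈ Set.Icc (-1 : ℝ) 1 ∧ binTail S (e y) 0 = binTail s 0 (-y))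
    (hn : 64 * hintConst c ^ 2 * l ^ 4 ≤ n) (hy : |(y : ℝ)| ≤ l * n) {z : ℤ} (hz : |z| ≤ n) :
    |e (y + z)| ≤ 1 / 2 :=
  bias_le_half hl (le_of_hintConst_le hl hc hn) hnm hs hS he (shifted_abs_le hl hy hz)

/-- The shift of the mean of the hint vector caused by the hinted coins. -/
theorem hint_mean_shift_le (hl : 1 ≤ l) (hc : 1 ≤ c)
    (hnm : n ≤ m) (hs : n ^ 2 ≤ 4 * s) (hS : m ^ 2 ≤ 4 * S) (hS2 : S ≤ m ^ 2)
    (he : ∀ y, e y ∈ Set.Icc (-1 : ℝ) 1 ∧ binTail S (e y) 0 = binTail s 0 (-y))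
    (hn : 64 * hintConst c ^ 2 * l ^ 4 ≤ n) (hy : |(y : ℝ)| ≤ l * n) {z : ℤ} (hz : |z| ≤ n) :
    |((c * S : ℕ) : ℝ) * e (y + z) - ((c * S : ℕ) : ℝ) * e y| ≤
      2560 * c * l * Real.sqrt ((c * S : ℕ) : ℝ) := by
  have hd := shifted_bias_sub_le hl hc hnm hs hS he hn hy hz
  have hn2 := le_of_hintConst_le hl hc hn
  have hn0 : (0 : ℝ) < n := by nlinarith
  have hm0 : (0 : ℝ) < m := hn0.trans_le (by exact_mod_cast hnm)
  have hq := sqrt_vector_length_le hc hS2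
  have hz1 : |(z : ℝ)| ≤ n := by exact_mod_cast hz
  set q := Real.sqrt ((c * S : ℕ) : ℝ) with hqdef
  have hqq : ((c * S : ℕ) : ℝ) = q * q := (Real.mul_self_sqrt (by positivity)).symm
  rw [← mul_sub, abs_mul, hqq, abs_of_nonneg (by positivity)]
  calc _ ≤ q * (c * m) * (2560 * l / (n * m) * n) := by gcongr; exact hd.trans (by gcongr)
    _ = _ := by field_simp

theorem abs_posterior_sub_le (hl : 1 ≤ l) (hc : 1 ≤ c)
    (hnm : n ≤ m) (hs : n ^ 2 ≤ 4 * s) (hS : m ^ 2 ≤ 4 * S) (hS2 : S ≤ m ^ 2)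
    (he : ∀ y, e y ∈ Set.Icc (-1 : ℝ) 1 ∧ binTail S (e y) 0 = binTail s 0 (-y))
    (hn : 64 * hintConst c ^ 2 * l ^ 4 ≤ n) (hy : |(y : ℝ)| ≤ l * n) {v : Fin (c * S) → Bool}
    (hv : |vecSum v - ((c * S : ℕ) : ℝ) * e y| ≤
      (2 + 2560 * c) * l * Real.sqrt ((c * S : ℕ) : ℝ)) :
    |fairExp n (fun z => vecProb (e (y + z)) v * binTail s 0 (-(y + z))) /
        fairExp n (fun z => vecProb (e (y + z)) v) -
      fairExp n (fun z => binTail s 0 (-(y + z)))| ≤ 128 * hintConst c * l ^ 2 / n := by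
  have hn2 := le_of_hintConst_le hl hc hn
  have hn1 : (1 : ℝ) ≤ n := by nlinarith
  have hn0 : (0 : ℝ) < n := by linarith
  have hm0 : (0 : ℝ) < m := hn0.trans_le (by exact_mod_cast hnm)
  have hA := le_hintConst hc
  have hy0 : |e y| ≤ 1 / 2 := by
    simpa using shifted_bias_le_half hl hc hnm hs hS he hn hy (z := 0) (by simp)
  have hq := sqrt_vector_length_le hc hS2
  have key : ∀ z : ℤ, ∀ d t e0 : ℝ, |d| ≤ 2560 * l / (n * m) * |(z : ℝ)| →
      |t| ≤ (2 + 5120 * c) * l * Real.sqrt ((c * S : ℕ) : ℝ) → |e0| ≤ 1 / 2 →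
      d * t / (1 - e0 ^ 2) ≤ hintConst c * l ^ 2 / n * |(z : ℝ)| := by
    intro z d t e0 hd ht he0
    refine (le_abs_self _).trans ((abs_mul_div_one_sub_sq_le hd ht he0).trans ?_)
    calc _ ≤ 2 * (2560 * l / (n * m) * |(z : ℝ)|) * ((2 + 5120 * c) * l * (c * m)) := by gcongr
      _ = _ := by unfold hintConst; field_simp; ring
  have h := reweighted_sub_le (n := n) (W := fun z => vecProb (e (y + z)) v)
    (V := fun z => binTail s 0 (-(y + z))) (a := hintConst c * l ^ 2 / n) (b := 2 / n)
    (w := vecProb (e y) v) (v := binTail s 0 (-y)) (by exact_mod_cast hn1) (by positivity)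
    (by positivity) (vecProb_pos (by linarith) v) ?_ ?_ ?_ ?_
  · refine h.trans (le_of_eq ?_)
    field_simp; ring
  · rw [div_pow, mul_pow]
    rw [show 64 * (hintConst c ^ 2 * (l ^ 2) ^ 2 / (n : ℝ) ^ 2) * n =
      64 * hintConst c ^ 2 * l ^ 4 / n by field_simp]
    exact (div_le_one hn0).2 hn
  · intro z hz
    have hz2 := shifted_bias_le_half hl hc hnm hs hS he hn hy hz
    have h1 := vecProb_ratio_le hz2 hy0 v
    have h2 := key z (e y - e (y + z)) (vecSum v - ((c * S : ℕ) : ℝ) * e (y + z)) (e (y + z))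
      (by rw [abs_sub_comm]; exact shifted_bias_sub_le hl hc hnm hs hS he hn hy hz)
      (by
        have h3 := hint_mean_shift_le hl hc hnm hs hS hS2 he hn hy hz
        have h4 := abs_sub_le (vecSum v) (((c * S : ℕ) : ℝ) * e y) (((c * S : ℕ) : ℝ) * e (y + z))
        rw [abs_sub_comm (((c * S : ℕ) : ℝ) * e y)] at h4
        linarith) hz2
    rw [Real.exp_neg, ← div_eq_mul_inv, div_le_iff₀ (Real.exp_pos _)]
    refine h1.trans (mul_le_mul_of_nonneg_left (Real.exp_le_exp.2 h2) ?_)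
    exact vecProb_nonneg (by linarith) v
  · intro z hz
    have hz2 := shifted_bias_le_half hl hc hnm hs hS he hn hy hz
    have h1 := vecProb_ratio_le hy0 hz2 v
    have h2 := key z (e (y + z) - e y) (vecSum v - ((c * S : ℕ) : ℝ) * e y) (e y)
      (shifted_bias_sub_le hl hc hnm hs hS he hn hy hz)
      (hv.trans (by gcongr; norm_num)) hy0
    refine h1.trans (mul_le_mul_of_nonneg_left (Real.exp_le_exp.2 h2) ?_)
    exact vecProb_nonneg (by linarith) v
  · intro z hz
    have h1 := abs_binTail_zero_sub_le (s := s) (x := n / 2) (by positivity)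
      (by
        have : ((n : ℝ)) ^ 2 ≤ 4 * s := by exact_mod_cast hs
        rw [div_pow]; linarith) (-(y + z)) (-y)
    refine h1.trans (le_of_eq ?_)
    push_cast
    rw [show -((y : ℝ) + z) - -y = -z by ring, abs_neg]
    field_simp

theorem bad_hint_prob_le (hl : 1 ≤ l) (hc : 1 ≤ c)
    (hnm : n ≤ m) (hs : n ^ 2 ≤ 4 * s) (hS : m ^ 2 ≤ 4 * S) (hS2 : S ≤ m ^ 2)
    (he : ∀ y, e y ∈ Set.Icc (-1 : ℝ) 1 ∧ binTail S (e y) 0 = binTail s 0 (-y))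
    (hn : 64 * hintConst c ^ 2 * l ^ 4 ≤ n) (hy : |(y : ℝ)| ≤ l * n) {z : ℤ} (hz : |z| ≤ n) :
    ∑ v : Fin (c * S) → Bool, vecProb (e (y + z)) v *
      (if (2 + 2560 * c) * l * Real.sqrt ((c * S : ℕ) : ℝ) <
        |vecSum v - ((c * S : ℕ) : ℝ) * e y| then 1 else 0) ≤ 2 * Real.exp (-l ^ 2) := by
  have hn2 := le_of_hintConst_le hl hc hn
  have hn0 : (0 : ℝ) < n := by nlinarith
  have hm1 : (n : ℝ) ≤ m := by exact_mod_cast hnm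
  have hc1 : (1 : ℝ) ≤ c := by exact_mod_cast hc
  have hSr : (m : ℝ) ^ 2 ≤ 4 * S := by exact_mod_cast hS
  have hz2 := shifted_bias_le_half hl hc hnm hs hS he hn hy hz
  have h3 := hint_mean_shift_le hl hc hnm hs hS hS2 he hn hy hz
  set q := Real.sqrt ((c * S : ℕ) : ℝ) with hqdef
  have hqq : ((c * S : ℕ) : ℝ) = q ^ 2 := (Real.sq_sqrt (by positivity)).symm
  have hqm : m / 2 ≤ q := by
    rw [hqdef]
    apply Real.le_sqrt_of_sq_le
    push_cast
    have : (S : ℝ) ≤ c * S := le_mul_of_one_le_left (by positivity) hc1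
    rw [div_pow]; linarith
  have hlq : 2 * l ≤ q := by nlinarith
  have hq0 : 0 < q := by linarith
  have h := vecProb_tail (N := c * S) (e := e (y + z)) (u := 2 * l * q) (by linarith)
    (by positivity) (by rw [hqq, sq]; gcongr) (by
      have : (1 : ℝ) ≤ ((c * S : ℕ) : ℝ) := by rw [hqq]; nlinarith
      exact_mod_cast this)
  rw [hqq, show -((2 * l * q) ^ 2 / (4 * q ^ 2)) = -l ^ 2 by field_simp; ring] at h
  rw [hqq] at h3 ⊢
  refine le_trans (Finset.sum_le_sum fun v _ => ?_) h
  refine mul_le_mul_of_nonneg_left ?_ (vecProb_nonneg (by linarith) v)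
  split_ifs with h1 h2 h2
  · exact le_rfl
  · exfalso
    apply h2
    have h4 := abs_sub_le (vecSum v) (q ^ 2 * e (y + z)) (q ^ 2 * e y)
    linarith
  · exact zero_le_one
  · exact le_rfl

end

theorem fairExp_comm (a b : ℕ) (f : ℤ → ℤ → ℝ) :
    fairExp a (fun x => fairExp b (f x)) = fairExp b (fun y => fairExp a (fun x => f x y)) := by
  simp only [← sum_binPMF_zero_mul, Finset.mul_sum]
  rw [Finset.sum_comm]
  exact Finset.sum_congr rfl fun _ _ => Finset.sum_congr rfl fun _ _ => by ring

theorem sum_piFinset_succ {m : ℕ} (A : Fin (m + 1) → Finset ℤ) (F : (Fin (m + 1) → ℤ) → ℝ) :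
    ∑ x ∈ Fintype.piFinset A, F x =
      ∑ a ∈ A 0, ∑ x ∈ Fintype.piFinset (fun i : Fin m => A i.succ), F (Fin.cons a x) := by
  rw [← Finset.sum_product']
  refine Finset.sum_nbij' (fun x => (x 0, Fin.tail x)) (fun p => Fin.cons p.1 p.2)
    ?_ ?_ ?_ ?_ ?_
  · intro x hx
    simp only [Fintype.mem_piFinset] at hx
    simp only [Finset.mem_product, Fintype.mem_piFinset]
    exact ⟨hx 0, fun i => hx i.succ⟩
  · intro p hp
    simp only [Finset.mem_product, Fintype.mem_piFinset] at hp
    simp only [Fintype.mem_piFinset]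
    exact fun i => Fin.cases hp.1 hp.2 i
  · intro x _; exact Fin.cons_self_tail x
  · intro p _; simp
  · intro x _; rw [Fin.cons_self_tail]

/-- Expectation over independent fair binomials `x i` of `ℓ i` coins each. -/
noncomputable def walkExp {m : ℕ} (ℓ : Fin m → ℕ) (F : (Fin m → ℤ) → ℝ) : ℝ :=
  ∑ x ∈ Fintype.piFinset (fun i => Finset.Icc (-(ℓ i : ℤ)) (ℓ i)),
    (∏ i, binPMF (ℓ i) 0 (x i)) * F x

theorem walkExp_succ {m : ℕ} (ℓ : Fin (m + 1) → ℕ) (F : (Fin (m + 1) → ℤ) → ℝ) :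
    walkExp ℓ F = fairExp (ℓ 0) (fun a =>
      walkExp (fun i : Fin m => ℓ i.succ) (fun x => F (Fin.cons a x))) := by
  rw [walkExp, sum_piFinset_succ, ← sum_binPMF_zero_mul]
  refine Finset.sum_congr rfl fun a _ => ?_
  rw [walkExp, Finset.mul_sum]
  refine Finset.sum_congr rfl fun x _ => ?_
  rw [Fin.prod_univ_succ]
  simp only [Fin.cons_zero, Fin.cons_succ]
  ring

theorem walkExp_two_sums {m : ℕ} (ℓ : Fin m → ℕ) (p q : Fin m → Prop) [DecidablePred p]
    [DecidablePred q] (hpq : ∀ i, p i → ¬ q i) (g : ℤ → ℤ → ℝ) :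
    walkExp ℓ (fun x => g (∑ i with p i, x i) (∑ i with q i, x i)) =
      fairExp (∑ i with p i, ℓ i) (fun a => fairExp (∑ i with q i, ℓ i) (g a)) := by
  simp only [Finset.sum_filter]
  induction m generalizing g with
  | zero => simp [walkExp, fairExp]
  | succ m ih =>
    rw [walkExp_succ]
    simp only [Fin.sum_univ_succ, Fin.cons_zero, Fin.cons_succ]
    have key := fun g => ih (fun i => ℓ i.succ) (fun i => p i.succ) (fun i => q i.succ)
      (fun i => hpq i.succ) g
    by_cases hp : p 0
    · simp only [hp, hpq 0 hp, if_true, if_false, zero_add]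
      rw [fairExp_add_coins]
      congr 1; ext a
      exact key (fun a' b => g (a + a') b)
    · by_cases hq : q 0
      · simp only [hp, hq, if_true, if_false, zero_add]
        simp only [fairExp_add_coins (ℓ 0)]
        rw [fairExp_comm]
        congr 1; ext a
        exact key (fun a' b => g a' (a + b))
      · simp only [hp, hq, if_false, zero_add]
        rw [key, fairExp_const]

theorem walkExp_sum {m : ℕ} (ℓ : Fin m → ℕ) (p : Fin m → Prop) [DecidablePred p] (g : ℤ → ℝ) :
    walkExp ℓ (fun x => g (∑ i with p i, x i)) = fairExp (∑ i with p i, ℓ i) g := by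
  have h := walkExp_two_sums ℓ p (fun _ => False) (fun _ _ h => h) (fun a _ => g a)
  simpa only [fairExp_const] using h

theorem walkExp_add {m : ℕ} (ℓ : Fin m → ℕ) (F G : (Fin m → ℤ) → ℝ) :
    walkExp ℓ (fun x => F x + G x) = walkExp ℓ F + walkExp ℓ G := by
  simp only [walkExp, mul_add, Finset.sum_add_distrib]

theorem walkExp_finset_sum {ι : Type*} {m : ℕ} (ℓ : Fin m → ℕ) (s : Finset ι)
    (F : ι → (Fin m → ℤ) → ℝ) :
    walkExp ℓ (fun x => ∑ i ∈ s, F i x) = ∑ i ∈ s, walkExp ℓ (F i) := by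
  simp only [walkExp, Finset.mul_sum]
  exact Finset.sum_comm

theorem walkExp_mul_left {m : ℕ} (ℓ : Fin m → ℕ) (a : ℝ) (F : (Fin m → ℤ) → ℝ) :
    walkExp ℓ (fun x => a * F x) = a * walkExp ℓ F := by
  simp only [walkExp, Finset.mul_sum]
  exact Finset.sum_congr rfl fun _ _ => by ring

/-- Integrating independent hints against a function of one of them. -/
theorem sum_prod_hint_mul {H : Type} [Fintype H] {m : ℕ} (w : Fin m → H → ℝ)
    (hw : ∀ i, ∑ v, w i v = 1) (i : Fin m) (f : H → ℝ) :
    ∑ h : Fin m → H, (∏ j, w j (h j)) * f (h i) = ∑ v, w i v * f v := by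
  classical
  have h := Finset.prod_univ_sum (fun _ : Fin m => (Finset.univ : Finset H))
    (fun j v => w j v * (if j = i then f v else 1))
  rw [Fintype.piFinset_univ] at h
  simp only [Finset.prod_mul_distrib, Finset.prod_ite_eq', Finset.mem_univ, if_true] at h
  rw [← h, Finset.prod_eq_single i]
  · simp
  · intro j _ hj
    simp [hj, hw]
  · simp

theorem sum_prod_hint {H : Type} [Fintype H] {m : ℕ} (w : Fin m → H → ℝ)
    (hw : ∀ i, ∑ v, w i v = 1) : ∑ h : Fin m → H, ∏ j, w j (h j) = 1 := by
  classical
  have h := Finset.prod_univ_sum (fun _ : Fin m => (Finset.univ : Finset H)) w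
  rw [Fintype.piFinset_univ] at h
  rw [← h]
  simp [hw]

theorem abs_trajGain_le {H : Type} {m : ℕ} {hint : ℕ → ℤ → H → ℝ} {b : ℕ → ℤ → H → Bool} {F : ℝ}
    (x : Fin m → ℤ) (h : Fin m → H) (h0 : 0 ≤ F)
    (hF : ∀ i : Fin m, |roundO m 0 hint (i + 1) (partY m 0 x i) (h i) -
      roundOminus m 0 (i + 1) (partY m 0 x i)| ≤ F) :
    |trajGain m 0 0 hint b x h| ≤ F := by
  unfold trajGain
  split
  · exact hF _
  · simpa using h0

section
variable {H : Type} [Fintype H] {m : ℕ} {hint : ℕ → ℤ → H → ℝ} {b : ℕ → ℤ → H → Bool}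

theorem gameBias_le (hnn : ∀ r, 1 ≤ r → r ≤ m → ∀ y v, 0 ≤ hint r y v)
    {F : (Fin m → ℤ) → (Fin m → H) → ℝ} (hF : ∀ x h, |trajGain m 0 0 hint b x h| ≤ F x h) :
    gameBias m 0 0 hint b ≤ walkExp (fun i : Fin m => lRound m (i + 1)) (fun x =>
      ∑ h : Fin m → H, (∏ i : Fin m, hint (i + 1) (partY m 0 x (i + 1)) (h i)) * F x h) := by
  rw [gameBias, tsum_eq_sum (s := (Fintype.piFinset (fun i : Fin m =>
    Finset.Icc (-(lRound m (i + 1) : ℤ)) (lRound m (i + 1)))) ×ˢ Finset.univ)]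
  · refine (Finset.abs_sum_le_sum_abs _ _).trans ?_
    rw [walkExp, Finset.sum_product]
    refine Finset.sum_le_sum fun x _ => ?_
    rw [Finset.mul_sum]
    refine Finset.sum_le_sum fun h _ => ?_
    have h0 : 0 ≤ trajProb m 0 0 hint x h := Finset.prod_nonneg fun i _ =>
      mul_nonneg (binPMF_zero_nonneg _ _) (hnn _ (by omega) (by omega) _ _)
    rw [abs_mul, abs_of_nonneg h0, ← mul_assoc, ← Finset.prod_mul_distrib]
    exact mul_le_mul_of_nonneg_left (hF x h) h0
  · rintro ⟨x, h⟩ hq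
    have h1 : ∃ i : Fin m, ¬ |x i| ≤ (lRound m (i + 1) : ℤ) := by
      by_contra! hcon
      exact hq (Finset.mem_product.2 ⟨Fintype.mem_piFinset.2 fun i =>
        Finset.mem_Icc.2 (abs_le.1 (hcon i)), Finset.mem_univ _⟩)
    obtain ⟨i, hi⟩ := h1
    have : trajProb m 0 0 hint x h = 0 :=
      Finset.prod_eq_zero (Finset.mem_univ i) (by rw [binPMF_eq_zero hi, zero_mul])
    simp [this]

/-- Splitting the bias into a part controlled round by round and a part depending only on the
walk. -/
theorem gameBias_le_add (hnn : ∀ r, 1 ≤ r → r ≤ m → ∀ y v, 0 ≤ hint r y v)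
    (hsum : ∀ r, 1 ≤ r → r ≤ m → ∀ y, ∑ v, hint r y v = 1)
    {f : ℕ → ℤ → H → ℝ} {D : (Fin m → ℤ) → ℝ} {δ : ℝ}
    (hf : ∀ i y v, 0 ≤ f i y v) (hD : ∀ x, 0 ≤ D x)
    (hG : ∀ x v (i : Fin m), |roundO m 0 hint (i + 1) (partY m 0 x i) v -
      roundOminus m 0 (i + 1) (partY m 0 x i)| ≤ f i (partY m 0 x i) v + D x)
    (hδ : ∀ i < m, ∀ y, fairExp (lRound m (i + 1)) (fun z =>
      ∑ v, hint (i + 1) (y + z) v * f i y v) ≤ δ) :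
    gameBias m 0 0 hint b ≤
      m * δ + walkExp (fun i : Fin m => lRound m (i + 1)) D := by
  refine (gameBias_le hnn (F := fun x h => ∑ i : Fin m, f i (partY m 0 x i) (h i) + D x)
    fun x h => abs_trajGain_le x h ?_ fun i => ?_).trans ?_
  · exact add_nonneg (Finset.sum_nonneg fun i _ => hf _ _ _) (hD x)
  · refine (hG x (h i) i).trans (add_le_add ?_ le_rfl)
    exact Finset.single_le_sum (f := fun i : Fin m => f i (partY m 0 x i) (h i))
      (fun i _ => hf _ _ _) (Finset.mem_univ i)
  · have e : ∀ x : Fin m → ℤ, ∑ h : Fin m → H,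
        (∏ i : Fin m, hint (i + 1) (partY m 0 x (i + 1)) (h i)) *
          (∑ i : Fin m, f i (partY m 0 x i) (h i) + D x) =
        ∑ i : Fin m, ∑ v, hint (i + 1) (partY m 0 x (i + 1)) v * f i (partY m 0 x i) v + D x := by
      intro x
      simp only [mul_add, Finset.sum_add_distrib, Finset.mul_sum]
      rw [Finset.sum_comm, ← Finset.sum_mul, sum_prod_hint, one_mul]
      · congr 1
        refine Finset.sum_congr rfl fun i _ => ?_
        exact sum_prod_hint_mul (fun j : Fin m => hint (j + 1) (partY m 0 x (j + 1)))
          (fun j => hsum _ (by omega) (by omega) _) i _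
      · exact fun j => hsum _ (by omega) (by omega) _
    simp only [e]
    rw [walkExp_add, walkExp_finset_sum]
    refine add_le_add ?_ le_rfl
    have : ∀ i ∈ (Finset.univ : Finset (Fin m)), walkExp (fun i : Fin m => lRound m (i + 1))
        (fun x => ∑ v, hint (i + 1) (partY m 0 x (i + 1)) v * f i (partY m 0 x i) v) ≤ δ := by
      intro i _
      have h1 := walkExp_two_sums (fun i : Fin m => lRound m (i + 1))
        (fun j : Fin m => (j : ℕ) < i) (fun j : Fin m => j = i)
        (by rintro j hj rfl; exact lt_irrefl _ hj)
        (fun y z => ∑ v, hint (i + 1) (y + z) v * f i y v)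
      have e1 : ∀ g : Fin m → ℤ, ∑ j with j = i, g j = g i := fun g => by
        simp [Finset.sum_filter]
      have e2 : ∑ j : Fin m with j = i, lRound m (j + 1) = lRound m (i + 1) := by
        simp [Finset.sum_filter]
      have e3 : ∀ x : Fin m → ℤ, partY m 0 x (i + 1) =
          ∑ j with (fun j : Fin m => (j : ℕ) < i) j, x j + x i := by
        intro x
        rw [partY, zero_add, ← e1 x, ← Finset.sum_union]
        · congr 1
          ext j
          simp only [Finset.mem_filter, Finset.mem_univ, true_and, Finset.mem_union,
            Fin.ext_iff]
          omega
        · rw [Finset.disjoint_filter]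
          rintro j _ hj rfl
          exact lt_irrefl _ hj
      simp only [e1, e2] at h1
      simp only [e3]
      simp only [partY, zero_add]
      rw [h1]
      exact fairExp_le_of_le _ fun y _ => hδ i i.2 y
    refine (Finset.sum_le_sum this).trans ?_
    simp

end

theorem sRound_succ {m r : ℕ} (h : r ≤ m) : sRound m r = lRound m r + sRound m (r + 1) := by
  rw [sRound, sRound, ← Finset.add_sum_Ioc_eq_sum_Icc h]
  congr 2
  ext j
  simp only [Finset.mem_Ioc, Finset.mem_Icc]
  omega

theorem two_mul_sRound {m n : ℕ} (h : n ≤ m) : 2 * sRound m (m + 1 - n) = n * (n + 1) := by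
  induction n with
  | zero => simp [sRound]
  | succ n ih =>
    have h1 := ih (by omega)
    rw [sRound_succ (by omega), show m + 1 - (n + 1) + 1 = m + 1 - n by omega, mul_add, h1,
      lRound, show m + 1 - (m + 1 - (n + 1)) = n + 1 by omega]
    ring

theorem roundO_eq {H : Type} (m : ℕ) (hint : ℕ → ℤ → H → ℝ) (r : ℕ) (y : ℤ) (v : H) :
    roundO m 0 hint r y v =
      fairExp (lRound m r) (fun z => hint r (y + z) v * binTail (sRound m (r + 1)) 0 (-(y + z))) /
        fairExp (lRound m r) (fun z => hint r (y + z) v) := by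
  simp only [roundO, mul_assoc, ← sum_binPMF_zero_mul]

theorem roundOminus_eq {m r : ℕ} (hr : r ≤ m) (y : ℤ) : roundOminus m 0 r y =
    fairExp (lRound m r) (fun z => binTail (sRound m (r + 1)) 0 (-(y + z))) := by
  rw [roundOminus, sRound_succ hr, binTail_add_coins]

section
variable {H : Type} {n : ℕ} {W : ℤ → H → ℝ} {V : ℤ → ℝ}

theorem posterior_mul_eq (hW : ∀ (z : ℤ) v, |z| ≤ n → 0 ≤ W z v) (hV0 : ∀ z, 0 ≤ V z)
    (hV1 : ∀ z, V z ≤ 1) (v : H) :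
    fairExp n (fun z => W z v) * (fairExp n (fun z => W z v * V z) / fairExp n (fun z => W z v)) =
      fairExp n (fun z => W z v * V z) := by
  refine mul_div_cancel_of_imp' fun h => le_antisymm ?_ ?_
  · rw [← h]
    exact fairExp_mono n fun z hz => mul_le_of_le_one_right (hW z v hz) (hV1 z)
  · exact fairExp_nonneg n fun z hz => mul_nonneg (hW z v hz) (hV0 z)

theorem posterior_mem (hW : ∀ (z : ℤ) v, |z| ≤ n → 0 ≤ W z v) (hV0 : ∀ z, 0 ≤ V z)
    (hV1 : ∀ z, V z ≤ 1) (v : H) :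
    0 ≤ fairExp n (fun z => W z v * V z) / fairExp n (fun z => W z v) ∧
      fairExp n (fun z => W z v * V z) / fairExp n (fun z => W z v) ≤ 1 := by
  have h1 := fairExp_nonneg n (f := fun z => W z v) fun z hz => hW z v hz
  have h2 := fairExp_nonneg n (f := fun z => W z v * V z) fun z hz =>
    mul_nonneg (hW z v hz) (hV0 z)
  exact ⟨div_nonneg h2 h1, div_le_one_of_le₀ (fairExp_mono n fun z hz =>
    mul_le_of_le_one_right (hW z v hz) (hV1 z)) h1⟩

variable [Fintype H] in
/-- The posterior stays close to the prior on average when the prior is nearly deterministic. -/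
theorem sum_abs_posterior_sub_le (hW : ∀ (z : ℤ) v, |z| ≤ n → 0 ≤ W z v)
    (hsum : ∀ z, ∑ v, W z v = 1) (hV0 : ∀ z, 0 ≤ V z) (hV1 : ∀ z, V z ≤ 1) {d : ℝ}
    (hd : fairExp n V ≤ d ∨ 1 - fairExp n V ≤ d) :
    fairExp n (fun z => ∑ v, W z v *
      |fairExp n (fun z => W z v * V z) / fairExp n (fun z => W z v) - fairExp n V|) ≤ 2 * d := by
  set o := fairExp n V with ho
  have ho0 : 0 ≤ o := fairExp_nonneg n fun z _ => hV0 z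
  have ho1 : o ≤ 1 := fairExp_le_of_le n fun z _ => hV1 z
  have hp : ∑ v, fairExp n (fun z => W z v) = 1 := by
    rw [← fairExp_sum n Finset.univ (fun v z => W z v)]
    simp only [hsum, fairExp_const]
  have hq : ∑ v, fairExp n (fun z => W z v * V z) = o := by
    rw [← fairExp_sum n Finset.univ (fun v z => W z v * V z)]
    simp only [← Finset.sum_mul, hsum, one_mul]
    rfl
  rw [fairExp_sum n Finset.univ]
  have hterm : ∀ v, fairExp n (fun z => W z v *
      |fairExp n (fun z => W z v * V z) / fairExp n (fun z => W z v) - o|) =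
      |fairExp n (fun z => W z v * V z) - fairExp n (fun z => W z v) * o| := by
    intro v
    have h1 := fairExp_mul_left n
      |fairExp n (fun z => W z v * V z) / fairExp n (fun z => W z v) - o| (fun z => W z v)
    simp only [mul_comm |_|] at h1
    have h2 : 0 ≤ fairExp n (fun z => W z v) := fairExp_nonneg n fun z hz => hW z v hz
    rw [h1, ← abs_of_nonneg h2, ← abs_mul, abs_of_nonneg h2, mul_sub,
      posterior_mul_eq hW hV0 hV1]
  simp only [hterm]
  have hb : ∀ v, 0 ≤ fairExp n (fun z => W z v * V z) ∧
      fairExp n (fun z => W z v * V z) ≤ fairExp n (fun z => W z v) := fun v =>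
    ⟨fairExp_nonneg n fun z hz => mul_nonneg (hW z v hz) (hV0 z),
      fairExp_mono n fun z hz => mul_le_of_le_one_right (hW z v hz) (hV1 z)⟩
  rcases hd with hd | hd
  · calc _ ≤ ∑ v, (fairExp n (fun z => W z v * V z) + fairExp n (fun z => W z v) * o) := by
          refine Finset.sum_le_sum fun v _ => ?_
          obtain ⟨h1, h2⟩ := hb v
          have := mul_nonneg (h1.trans h2) ho0
          rw [abs_le]; constructor <;> linarith
      _ = 2 * o := by rw [Finset.sum_add_distrib, ← Finset.sum_mul, hp, hq]; ring
      _ ≤ _ := by linarith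
  · calc _ ≤ ∑ v, (fairExp n (fun z => W z v) - fairExp n (fun z => W z v * V z) +
            fairExp n (fun z => W z v) * (1 - o)) := by
          refine Finset.sum_le_sum fun v _ => ?_
          obtain ⟨h1, h2⟩ := hb v
          have := mul_nonneg (h1.trans h2) (sub_nonneg.2 ho1)
          rw [abs_le]; constructor <;> linarith
      _ = 2 * (1 - o) := by
          rw [Finset.sum_add_distrib, Finset.sum_sub_distrib, ← Finset.sum_mul, hp, hq]; ring
      _ ≤ _ := by linarith

end

theorem binTail_zero_far {s k : ℕ} (hk : s ≤ k ^ 2) (hk0 : 0 < k) {l : ℝ} (hl : 0 ≤ l) {y : ℤ}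
    (hy : l * k < |(y : ℝ)|) :
    binTail s 0 (-y) ≤ Real.exp (-(l ^ 2 / 2)) ∨ 1 - binTail s 0 (-y) ≤ Real.exp (-(l ^ 2 / 2)) := by
  have key : ∀ j : ℤ, l * k ≤ j → binTail s 0 j ≤ Real.exp (-(l ^ 2 / 2)) := by
    intro j hj
    rw [binTail_zero_eq]
    refine (fairExp_mono s fun z _ => ?_).trans (fairExp_tail_le hk hk0 l hl)
    split_ifs with h1 h2 h2
    · exact le_rfl
    · exact absurd (hj.trans (by exact_mod_cast h1)) h2
    · exact zero_le_one
    · exact le_rfl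
  rcases lt_abs.1 hy with h | h
  · right
    rw [one_sub_binTail_zero]
    exact key _ (by push_cast; linarith)
  · left
    exact key _ (by push_cast; linarith)

theorem sq_le_four_mul_sRound_succ {m i : ℕ} (h : 2 ≤ m - i) :
    (m - i) ^ 2 ≤ 4 * sRound m (i + 1 + 1) := by
  have h1 := two_mul_sRound (m := m) (n := m - i - 1) (by omega)
  rw [show m + 1 - (m - i - 1) = i + 1 + 1 by omega] at h1
  obtain ⟨k, hk⟩ := Nat.exists_eq_add_of_le h
  rw [hk] at h1 ⊢
  rw [show 2 + k - 1 = k + 1 by omega] at h1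
  nlinarith

theorem sRound_one_bounds (m : ℕ) : m ^ 2 ≤ 4 * sRound m 1 ∧ sRound m 1 ≤ m ^ 2 := by
  have h1 := two_mul_sRound (m := m) (n := m) le_rfl
  rw [show m + 1 - m = 1 by omega] at h1
  constructor
  · nlinarith
  · rcases m with _ | m
    · simp at h1; simp [h1]
    · nlinarith

theorem sRound_le_sq {m i : ℕ} (h : i < m) : sRound m (i + 1) ≤ (m - i) ^ 2 := by
  have h1 := two_mul_sRound (m := m) (n := m - i) (by omega)
  rw [show m + 1 - (m - i) = i + 1 by omega] at h1
  have : 1 ≤ m - i := by omega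
  nlinarith

theorem abs_vector_gain_le_one {N m i : ℕ} {epsf : ℕ → ℤ → ℝ}
    (he : ∀ y : ℤ, epsf (i + 1) y ∈ Set.Icc (-1 : ℝ) 1) (y : ℤ) (v : Fin N → Bool) :
    |roundO m 0 (vectorHint N epsf) (i + 1) y v - roundOminus m 0 (i + 1) y| ≤ 1 := by
  have hW : ∀ (z : ℤ) (v : Fin N → Bool), |z| ≤ (lRound m (i + 1) : ℤ) →
      0 ≤ vectorHint N epsf (i + 1) (y + z) v := fun z v _ =>
    vecProb_nonneg (abs_le.2 (he _)) v
  have h1 := posterior_mem hW (fun z => binTail_zero_nonneg (sRound m (i + 1 + 1)) (-(y + z)))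
    (fun z => binTail_zero_le_one _ _) v
  have h2 := binTail_zero_nonneg (sRound m (i + 1)) (-y)
  have h3 := binTail_zero_le_one (sRound m (i + 1)) (-y)
  rw [roundO_eq, roundOminus, abs_le]
  constructor <;> linarith [h1.1, h1.2]

theorem exists_round_bound {c m : ℕ} (hc : 1 ≤ c) {l : ℝ} (hl : 1 ≤ l) {epsf : ℕ → ℤ → ℝ}
    (he : ∀ r : ℕ, 1 ≤ r → r ≤ m → ∀ y : ℤ, epsf r y ∈ Set.Icc (-1 : ℝ) 1 ∧
      binTail (sRound m 1) (epsf r y) 0 = binTail (sRound m (r + 1)) 0 (-y)) :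
    ∃ f : ℕ → ℤ → (Fin (c * sRound m 1) → Bool) → ℝ, (∀ i y v, 0 ≤ f i y v) ∧
      (∀ i < m, ∀ y v, |roundO m 0 (vectorHint (c * sRound m 1) epsf) (i + 1) y v -
          roundOminus m 0 (i + 1) y| ≤ f i y v +
        if |(y : ℝ)| ≤ l * (m - i : ℕ) then 128 * hintConst c * l ^ 2 / (m - i : ℕ) +
          (if ((m - i : ℕ) : ℝ) < 64 * hintConst c ^ 2 * l ^ 4 then 1 else 0) else 0) ∧
      ∀ i < m, ∀ y, fairExp (lRound m (i + 1)) (fun z =>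
        ∑ v, vectorHint (c * sRound m 1) epsf (i + 1) (y + z) v * f i y v) ≤
          2 * Real.exp (-(l ^ 2 / 2)) := by
  have hℓ : ∀ i, lRound m (i + 1) = m - i := fun i => by rw [lRound]; omega
  set N := c * sRound m 1 with hN
  have hA := le_hintConst hc
  refine ⟨fun i y v => if l * (m - i : ℕ) < |(y : ℝ)| then
      |roundO m 0 (vectorHint N epsf) (i + 1) y v - roundOminus m 0 (i + 1) y|
    else if 64 * hintConst c ^ 2 * l ^ 4 ≤ ((m - i : ℕ) : ℝ) ∧
      (2 + 2560 * c) * l * Real.sqrt (N : ℝ) < |vecSum v - N * epsf (i + 1) y| then 1 else 0,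
    ?_, ?_, ?_⟩
  · intro i y v
    dsimp only
    split_ifs <;> positivity
  · intro i hi y v
    have he' := he (i + 1) (by omega) (by omega)
    dsimp only
    by_cases hy : l * (m - i : ℕ) < |(y : ℝ)|
    · rw [if_pos hy, if_neg (not_le.2 hy), add_zero]
    · rw [if_neg hy, if_pos (not_lt.1 hy)]
      have hone := abs_vector_gain_le_one (m := m) (N := N) (fun y => (he' y).1) y v
      have hKn : 0 ≤ 128 * hintConst c * l ^ 2 / ((m - i : ℕ) : ℝ) := by positivity
      rw [roundO_eq, roundOminus_eq (by omega), hℓ] at hone ⊢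
      by_cases hL : 64 * hintConst c ^ 2 * l ^ 4 ≤ ((m - i : ℕ) : ℝ)
      · rw [if_neg (not_lt.2 hL), add_zero]
        by_cases hb : (2 + 2560 * c) * l * Real.sqrt (N : ℝ) <
          |vecSum v - N * epsf (i + 1) y|
        · rw [if_pos ⟨hL, hb⟩]
          linarith
        · rw [if_neg (fun h => hb h.2), zero_add]
          have hn2 := le_of_hintConst_le hl hc hL
          have hn3 : 2 ≤ m - i := by
            have : (2 : ℝ) ≤ ((m - i : ℕ) : ℝ) := by nlinarith
            exact_mod_cast this
          exact abs_posterior_sub_le hl hc (by omega) (sq_le_four_mul_sRound_succ hn3)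
            (sRound_one_bounds m).1 (sRound_one_bounds m).2 he' hL (not_lt.1 hy) (not_lt.1 hb)
      · rw [if_pos (not_le.1 hL), if_neg (fun h => hL h.1), zero_add]
        linarith
  · intro i hi y
    have he' := he (i + 1) (by omega) (by omega)
    dsimp only
    by_cases hy : l * (m - i : ℕ) < |(y : ℝ)|
    · simp only [if_pos hy, roundO_eq]
      rw [roundOminus_eq (by omega)]
      refine sum_abs_posterior_sub_le (W := fun z v => vectorHint N epsf (i + 1) (y + z) v)
        (V := fun z => binTail (sRound m (i + 1 + 1)) 0 (-(y + z))) (fun z v _ => vecProb_nonneg (abs_le.2 (he' _).1) v)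
        (fun z => sum_vecProb N _) (fun z => binTail_zero_nonneg _ _)
        (fun z => binTail_zero_le_one _ _) ?_
      rw [← roundOminus_eq (by omega)]
      exact binTail_zero_far (sRound_le_sq hi) (by omega) (by linarith) hy
    · simp only [if_neg hy, hℓ]
      by_cases hL : 64 * hintConst c ^ 2 * l ^ 4 ≤ ((m - i : ℕ) : ℝ)
      · simp only [hL, true_and]
        have hn2 := le_of_hintConst_le hl hc hL
        have hn3 : 2 ≤ m - i := by
          have : (2 : ℝ) ≤ ((m - i : ℕ) : ℝ) := by nlinarith
          exact_mod_cast this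
        have hexp : Real.exp (-l ^ 2) ≤ Real.exp (-(l ^ 2 / 2)) :=
          Real.exp_le_exp.2 (by nlinarith [sq_nonneg l])
        refine (fairExp_le_of_le (m - i) fun z hz => ?_).trans
          (mul_le_mul_of_nonneg_left hexp zero_le_two)
        exact bad_hint_prob_le hl hc (by omega) (sq_le_four_mul_sRound_succ hn3)
          (sRound_one_bounds m).1 (sRound_one_bounds m).2 he' hL (not_lt.1 hy) hz
      · simp only [hL, false_and, if_false, mul_zero, Finset.sum_const_zero, fairExp_const]
        positivity

theorem sum_filter_lt_lRound {m j : ℕ} (hj : j ≤ m) :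
    ∑ a ∈ Finset.univ.filter (fun a : Fin m => (a : ℕ) < j), lRound m (a + 1) + sRound m (j + 1) = sRound m 1 := by
  rw [Finset.sum_filter,
    Fin.sum_univ_eq_sum_range (fun a => if a < j then lRound m (a + 1) else 0) m,
    ← Finset.sum_filter]
  have : (Finset.range m).filter (· < j) = Finset.range j := by
    ext a; simp only [Finset.mem_filter, Finset.mem_range]; omega
  rw [this]
  clear this
  induction j with
  | zero => simp
  | succ j ih =>
    rw [Finset.sum_range_succ, ← ih (by omega), sRound_succ hj]
    ring

theorem sum_filter_Ico_lRound_le {m i j : ℕ} (hj : j < m) :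
    ∑ a ∈ Finset.univ.filter (fun a : Fin m => j ≤ (a : ℕ) ∧ (a : ℕ) < i), lRound m (a + 1) ≤ (m - j) ^ 2 := by
  have h1 := sum_filter_lt_lRound hj.le
  have h2 := sum_filter_lt_lRound (le_refl m)
  have h3 : sRound m (m + 1) = 0 := by simp [sRound]
  have h4 : ∑ a ∈ Finset.univ.filter (fun a : Fin m => (a : ℕ) < j), lRound m (a + 1) +
      ∑ a ∈ Finset.univ.filter (fun a : Fin m => ¬ (a : ℕ) < j), lRound m (a + 1) =
      ∑ a ∈ Finset.univ.filter (fun a : Fin m => (a : ℕ) < m), lRound m (a + 1) := by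
    rw [Finset.sum_filter_add_sum_filter_not, Finset.filter_true_of_mem fun a _ => a.2]
  have h5 : ∑ a ∈ Finset.univ.filter (fun a : Fin m => j ≤ (a : ℕ) ∧ (a : ℕ) < i), lRound m (a + 1) ≤
      ∑ a ∈ Finset.univ.filter (fun a : Fin m => ¬ (a : ℕ) < j), lRound m (a + 1) :=
    Finset.sum_le_sum_of_subset fun a => by
      simp only [Finset.mem_filter, Finset.mem_univ, true_and]; omega
  have h6 := sRound_le_sq hj
  omega

theorem fairExp_abs_le_le {n : ℕ} {x R : ℝ} (hx : 0 < x) (hn : x ^ 2 ≤ n + 1) (hR : 0 ≤ R) :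
    fairExp n (fun z => if |(z : ℝ)| ≤ R then 1 else 0) ≤ (2 * R + 1) / x := by
  rw [← sum_binPMF_zero_mul]
  have hsub : ∀ z : ℤ, |(z : ℝ)| ≤ R → z ∈ Finset.Icc (-⌊R⌋) ⌊R⌋ := by
    intro z hz
    rw [Finset.mem_Icc, ← abs_le, Int.le_floor]
    exact_mod_cast hz
  calc _ = ∑ z ∈ (Finset.Icc (-(n : ℤ)) n).filter (fun z : ℤ => |(z : ℝ)| ≤ R),
        binPMF n 0 z := by rw [Finset.sum_filter]; simp
    _ ≤ ∑ z ∈ Finset.Icc (-⌊R⌋) ⌊R⌋, binPMF n 0 z :=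
        Finset.sum_le_sum_of_subset_of_nonneg
          (fun z hz => hsub z (Finset.mem_filter.1 hz).2) fun z _ _ => binPMF_zero_nonneg n z
    _ ≤ ∑ z ∈ Finset.Icc (-⌊R⌋) ⌊R⌋, 1 / x := Finset.sum_le_sum fun z _ => binPMF_zero_le hx hn z
    _ ≤ _ := by
        have h0 : 0 ≤ ⌊R⌋ := Int.floor_nonneg.2 hR
        have h1 : ((⌊R⌋ + 1 - -⌊R⌋).toNat : ℝ) = 2 * ⌊R⌋ + 1 := by
          have : ((⌊R⌋ + 1 - -⌊R⌋).toNat : ℤ) = 2 * ⌊R⌋ + 1 := by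
            rw [Int.toNat_of_nonneg (by omega)]; ring
          exact_mod_cast this
        rw [Finset.sum_const, Int.card_Icc, nsmul_eq_mul, h1, mul_one_div]
        have := Int.floor_le R
        gcongr

/-- Anti-concentration of the walk before the last `m - j` rounds. -/
theorem walk_near_zero_le {m j : ℕ} (hj : j < m) {l : ℝ} (hl : 1 ≤ l) :
    walkExp (fun i : Fin m => lRound m (i + 1)) (fun x =>
      if |(partY m 0 x j : ℝ)| ≤ 2 * l * (m - j : ℕ) then 1 else 0) ≤
      12 * l * (m - j : ℕ) / m := by
  simp only [partY, zero_add]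
  rw [walkExp_sum (fun i : Fin m => lRound m (i + 1)) (fun a : Fin m => (a : ℕ) < j)
    (fun y => if |(y : ℝ)| ≤ 2 * l * (m - j : ℕ) then 1 else 0)]
  set k := m - j with hk
  have hm0 : (0 : ℝ) < m := by exact_mod_cast (by omega : 0 < m)
  have hk1 : (1 : ℝ) ≤ k := by exact_mod_cast (by omega : 1 ≤ k)
  have hlk : 1 ≤ l * k := by nlinarith
  rcases le_total (2 * k) m with h | h
  · have h1 := sum_filter_lt_lRound hj.le
    have h2 := two_mul_sRound (m := m) (n := m) le_rfl
    have h3 := two_mul_sRound (m := m) (n := k) (by omega)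
    rw [show m + 1 - m = 1 by omega] at h2
    rw [show m + 1 - k = j + 1 by omega] at h3
    set n := ∑ a ∈ Finset.univ.filter (fun a : Fin m => (a : ℕ) < j), lRound m (a + 1)
    have h4 : m ^ 2 ≤ 4 * n := by nlinarith
    have h5 : (m : ℝ) ^ 2 ≤ 4 * n := by exact_mod_cast h4
    refine (fairExp_abs_le_le (x := m / 2) (by positivity) (by rw [div_pow]; linarith)
      (by positivity)).trans ?_
    rw [div_le_div_iff₀ (by positivity) hm0]
    nlinarith
  · have h1 : (m : ℝ) ≤ 2 * k := by exact_mod_cast h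
    refine (fairExp_le_of_le _ (a := 1) fun z _ => by split_ifs <;> norm_num).trans ?_
    rw [le_div_iff₀ hm0]
    nlinarith

theorem walk_increment_le {m i j : ℕ} (hij : j ≤ i) (hj : j < m) {l : ℝ} (hl : 0 ≤ l) :
    walkExp (fun i : Fin m => lRound m (i + 1)) (fun x =>
      if l * (m - j : ℕ) ≤ |((partY m 0 x i - partY m 0 x j : ℤ) : ℝ)| then 1 else 0) ≤
      2 * Real.exp (-(l ^ 2 / 2)) := by
  have e : ∀ x : Fin m → ℤ, partY m 0 x i - partY m 0 x j =
      ∑ a with (fun a : Fin m => j ≤ (a : ℕ) ∧ (a : ℕ) < i) a, x a := by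
    intro x
    simp only [partY, zero_add, Finset.sum_filter, ← Finset.sum_sub_distrib]
    refine Finset.sum_congr rfl fun a _ => ?_
    split_ifs <;> omega
  simp only [e]
  rw [walkExp_sum (fun i : Fin m => lRound m (i + 1))
    (fun a : Fin m => j ≤ (a : ℕ) ∧ (a : ℕ) < i)
    (fun y => if l * (m - j : ℕ) ≤ |(y : ℝ)| then 1 else 0)]
  exact fairExp_abs_tail_le (sum_filter_Ico_lRound_le hj) (by omega) l hl

/-- A functional of the walk dominating a weight collected at any round in which the walk is
close to zero; the weight `ω j` is charged to round `j`. -/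
noncomputable def walkCharge (m : ℕ) (l : ℝ) (ω : ℕ → ℝ) (x : Fin m → ℤ) : ℝ :=
  ∑ j ∈ Finset.range m, ω j *
      (if |(partY m 0 x j : ℝ)| ≤ 2 * l * (m - j : ℕ) then 1 else 0) +
    ∑ i ∈ Finset.range m, ∑ j ∈ Finset.range (i + 1), ω j *
      (if l * (m - j : ℕ) ≤ |((partY m 0 x i - partY m 0 x j : ℤ) : ℝ)| then 1 else 0)

theorem walkCharge_nonneg (m : ℕ) (l : ℝ) {ω : ℕ → ℝ} (hω : ∀ j, 0 ≤ ω j) (x : Fin m → ℤ) :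
    0 ≤ walkCharge m l ω x := by
  refine add_nonneg (Finset.sum_nonneg fun j _ => ?_)
    (Finset.sum_nonneg fun i _ => Finset.sum_nonneg fun j _ => ?_)
  all_goals exact mul_nonneg (hω j) (by split_ifs <;> norm_num)

theorem le_walkCharge {m : ℕ} {l : ℝ} (hl : 0 ≤ l) {ω : ℕ → ℝ} (hω : ∀ j, 0 ≤ ω j)
    (x : Fin m → ℤ) {i : ℕ} (hi : i < m) {κ : ℝ} (hκ : κ ≤ ∑ j ∈ Finset.range (i + 1), ω j)
    (hx : |(partY m 0 x i : ℝ)| ≤ l * (m - i : ℕ)) : κ ≤ walkCharge m l ω x := by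
  have h1 : ∑ j ∈ Finset.range (i + 1), ω j *
      (if |(partY m 0 x j : ℝ)| ≤ 2 * l * (m - j : ℕ) then 1 else 0) ≤
      ∑ j ∈ Finset.range m, ω j *
      (if |(partY m 0 x j : ℝ)| ≤ 2 * l * (m - j : ℕ) then 1 else 0) :=
    Finset.sum_le_sum_of_subset_of_nonneg (Finset.range_subset_range.2 hi) fun j _ _ =>
      mul_nonneg (hω j) (by split_ifs <;> norm_num)
  have h2 := Finset.single_le_sum (f := fun i => ∑ j ∈ Finset.range (i + 1), ω j *
      (if l * (m - j : ℕ) ≤ |((partY m 0 x i - partY m 0 x j : ℤ) : ℝ)| then (1 : ℝ) else 0))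
    (fun i _ => Finset.sum_nonneg fun j _ => mul_nonneg (hω j) (by split_ifs <;> norm_num))
    (Finset.mem_range.2 hi)
  refine hκ.trans (le_trans ?_ (add_le_add h1 h2))
  rw [← Finset.sum_add_distrib]
  refine Finset.sum_le_sum fun j hj => ?_
  rw [← mul_add]
  refine le_mul_of_one_le_right (hω j) ?_
  have hji : j ≤ i := by simpa [Nat.lt_succ_iff] using hj
  by_cases h3 : l * (m - j : ℕ) ≤ |((partY m 0 x i - partY m 0 x j : ℤ) : ℝ)|
  · rw [if_pos h3]; split_ifs <;> norm_num
  · rw [if_pos, if_neg h3, add_zero]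
    rw [not_le] at h3
    push_cast at h3
    have h4 : ((m - i : ℕ) : ℝ) ≤ (m - j : ℕ) := by exact_mod_cast (by omega : m - i ≤ m - j)
    have h5 := mul_le_mul_of_nonneg_left h4 hl
    have h6 := abs_sub_abs_le_abs_sub (partY m 0 x j : ℝ) (partY m 0 x i)
    rw [abs_sub_comm] at h6
    linarith

theorem walkExp_walkCharge_le {m : ℕ} {l : ℝ} (hl : 1 ≤ l) {ω : ℕ → ℝ} (hω : ∀ j, 0 ≤ ω j) :
    walkExp (fun i : Fin m => lRound m (i + 1)) (walkCharge m l ω) ≤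
      (12 * l / m + 2 * m * Real.exp (-(l ^ 2 / 2))) *
        ∑ j ∈ Finset.range m, ω j * (m - j : ℕ) := by
  unfold walkCharge
  rw [walkExp_add, walkExp_finset_sum, walkExp_finset_sum]
  simp only [walkExp_finset_sum, walkExp_mul_left]
  have hE := (Real.exp_pos (-(l ^ 2 / 2))).le
  set E := Real.exp (-(l ^ 2 / 2)) with hEdef
  have h1 : ∑ j ∈ Finset.range m, ω j * walkExp (fun i : Fin m => lRound m (i + 1)) (fun x =>
      if |(partY m 0 x j : ℝ)| ≤ 2 * l * (m - j : ℕ) then 1 else 0) ≤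
      12 * l / m * ∑ j ∈ Finset.range m, ω j * (m - j : ℕ) := by
    rw [Finset.mul_sum]
    refine Finset.sum_le_sum fun j hj => ?_
    refine (mul_le_mul_of_nonneg_left (walk_near_zero_le (Finset.mem_range.1 hj) hl)
      (hω j)).trans (le_of_eq (by ring))
  have h2 : ∀ i ∈ Finset.range m, ∑ j ∈ Finset.range (i + 1),
      ω j * walkExp (fun i : Fin m => lRound m (i + 1)) (fun x =>
      if l * (m - j : ℕ) ≤ |((partY m 0 x i - partY m 0 x j : ℤ) : ℝ)| then 1 else 0) ≤
      2 * E * ∑ j ∈ Finset.range m, ω j * (m - j : ℕ) := by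
    intro i hi
    have hi := Finset.mem_range.1 hi
    have hsub : ∑ j ∈ Finset.range (i + 1), ω j * (m - j : ℕ) ≤
        ∑ j ∈ Finset.range m, ω j * (m - j : ℕ) :=
      Finset.sum_le_sum_of_subset_of_nonneg (Finset.range_subset_range.2 hi) fun j _ _ =>
        mul_nonneg (hω j) (by positivity)
    refine le_trans ?_ (mul_le_mul_of_nonneg_left hsub (by positivity))
    rw [Finset.mul_sum]
    refine Finset.sum_le_sum fun j hj => ?_
    have hj := Finset.mem_range.1 hj
    refine (mul_le_mul_of_nonneg_left (walk_increment_le (by omega) (by omega)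
      (by linarith)) (hω j)).trans ?_
    have h3 : (1 : ℝ) ≤ (m - j : ℕ) := by exact_mod_cast (by omega : 1 ≤ m - j)
    have h4 : 0 ≤ ω j * (2 * E) := mul_nonneg (hω j) (by positivity)
    nlinarith
  refine (add_le_add h1 (Finset.sum_le_sum h2)).trans (le_of_eq ?_)
  rw [Finset.sum_const, Finset.card_range, nsmul_eq_mul]
  ring

theorem sum_range_one_div_sub_le (m : ℕ) :
    ∑ j ∈ Finset.range m, 1 / ((m - j : ℕ) : ℝ) ≤ 1 + Real.log m := by
  have h := harmonic_le_one_add_log m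
  rw [harmonic] at h
  push_cast at h
  refine le_trans (le_of_eq ?_) h
  rw [← Finset.sum_range_reflect]
  refine Finset.sum_congr rfl fun j hj => ?_
  have hj := Finset.mem_range.1 hj
  rw [show m - (m - 1 - j) = j + 1 by omega]
  push_cast
  rw [one_div]

/-- Weights charged to the rounds: a telescoping part producing `K / n` and a unit weight at the
round with `Λ` coins. -/
noncomputable def chargeWeight (m Λ : ℕ) (K : ℝ) (j : ℕ) : ℝ :=
  K * (1 / ((m - j : ℕ) : ℝ) ^ 2 + if j = 0 then 1 / (m : ℝ) else 0) +
    if j = m - Λ then 1 else 0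

theorem chargeWeight_nonneg {m Λ : ℕ} {K : ℝ} (hK : 0 ≤ K) (j : ℕ) : 0 ≤ chargeWeight m Λ K j := by
  unfold chargeWeight
  split_ifs <;> positivity

theorem one_div_sub_le_sum {m i : ℕ} (hi : i < m) : 1 / ((m - i : ℕ) : ℝ) ≤
    ∑ j ∈ Finset.range (i + 1), (1 / ((m - j : ℕ) : ℝ) ^ 2 + if j = 0 then 1 / (m : ℝ) else 0) := by
  induction i with
  | zero => simp
  | succ i ih =>
    rw [Finset.sum_range_succ, if_neg (by omega), add_zero]
    refine le_trans ?_ (add_le_add (ih (by omega)) le_rfl)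
    have e : ((m - i : ℕ) : ℝ) = ((m - (i + 1) : ℕ) : ℝ) + 1 := by
      rw [show m - i = m - (i + 1) + 1 by omega]; push_cast; ring
    have hx : (0 : ℝ) < ((m - (i + 1) : ℕ) : ℝ) := by exact_mod_cast (by omega : 0 < m - (i + 1))
    rw [e]
    set x : ℝ := ((m - (i + 1) : ℕ) : ℝ)
    rw [div_add_div _ _ (by positivity) (by positivity), div_le_div_iff₀ (by positivity)
      (by positivity)]
    nlinarith

theorem le_sum_chargeWeight {m i : ℕ} (hi : i < m) {K L : ℝ} (hK : 0 ≤ K) :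
    K / (m - i : ℕ) + (if ((m - i : ℕ) : ℝ) < L then 1 else 0) ≤
      ∑ j ∈ Finset.range (i + 1), chargeWeight m ⌊L⌋₊ K j := by
  simp only [chargeWeight]
  rw [Finset.sum_add_distrib, ← Finset.mul_sum, div_eq_mul_one_div]
  refine add_le_add (mul_le_mul_of_nonneg_left (one_div_sub_le_sum hi) hK) ?_
  rw [Finset.sum_ite_eq']
  split_ifs with h1 h2 h2
  · exact le_rfl
  · exfalso
    apply h2
    have h3 : m - i ≤ ⌊L⌋₊ := Nat.le_floor h1.le
    rw [Finset.mem_range]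
    omega
  · exact zero_le_one
  · exact le_rfl

theorem sum_chargeWeight_mul_le {m : ℕ} (hm : 1 ≤ m) {K L : ℝ} (hK : 0 ≤ K) (hL0 : 0 ≤ L)
    (hL : L ≤ m) : ∑ j ∈ Finset.range m, chargeWeight m ⌊L⌋₊ K j * (m - j : ℕ) ≤
      K * (2 + Real.log m) + L := by
  have hm0 : (0 : ℝ) < m := by exact_mod_cast hm
  have hfl : ⌊L⌋₊ ≤ m := Nat.floor_le_of_le hL
  have e : ∀ j ∈ Finset.range m, chargeWeight m ⌊L⌋₊ K j * (m - j : ℕ) =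
      K * (1 / ((m - j : ℕ) : ℝ)) + (if j = 0 then K else 0) +
        (if j = m - ⌊L⌋₊ then (⌊L⌋₊ : ℝ) else 0) := by
    intro j hj
    have hj := Finset.mem_range.1 hj
    have hx : (0 : ℝ) < ((m - j : ℕ) : ℝ) := by exact_mod_cast (by omega : 0 < m - j)
    rw [chargeWeight, add_mul]
    congr 1
    · rw [mul_assoc, add_mul, mul_add]
      congr 1
      · field_simp
      · split_ifs with h
        · subst h; simp; field_simp
        · simp
    · split_ifs with h
      · subst h; rw [one_mul, Nat.sub_sub_self hfl]
      · simp
  rw [Finset.sum_congr rfl e, Finset.sum_add_distrib, Finset.sum_add_distrib, ← Finset.mul_sum,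
    Finset.sum_ite_eq', Finset.sum_ite_eq', if_pos (Finset.mem_range.2 hm)]
  have h1 := mul_le_mul_of_nonneg_left (sum_range_one_div_sub_le m) hK
  have h2 := Nat.floor_le hL0
  have h3 : (if m - ⌊L⌋₊ ∈ Finset.range m then (⌊L⌋₊ : ℝ) else 0) ≤ L := by
    split_ifs
    · exact h2
    · exact hL0
  linarith

section
variable {c m : ℕ} {epsf : ℕ → ℤ → ℝ} (b : ℕ → ℤ → (Fin (c * sRound m 1) → Bool) → Bool)

theorem vectorGame_bias_le_one (he : ∀ r : ℕ, 1 ≤ r → r ≤ m → ∀ y : ℤ,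
      epsf r y ∈ Set.Icc (-1 : ℝ) 1 ∧
        binTail (sRound m 1) (epsf r y) 0 = binTail (sRound m (r + 1)) 0 (-y)) :
    gameBias m 0 0 (vectorHint (c * sRound m 1) epsf) b ≤ 1 := by
  have h := gameBias_le_add (b := b) (hint := vectorHint (c * sRound m 1) epsf)
    (f := fun _ _ _ => 0) (D := fun _ => 1) (δ := 0)
    (fun r h1 h2 y v => vecProb_nonneg (abs_le.2 (he r h1 h2 y).1) v)
    (fun r _ _ y => sum_vecProb _ _) (fun _ _ _ => le_rfl) (fun _ => zero_le_one)
    (fun x v i => by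
      rw [zero_add]
      exact abs_vector_gain_le_one (fun y => (he (i + 1) (by omega) (by omega) y).1) _ v)
    (fun i _ y => by simp [fairExp_const])
  have h2 := walkExp_sum (fun i : Fin m => lRound m (i + 1)) (fun _ => False) (fun _ => 1)
  rw [h2, fairExp_const] at h
  linarith

theorem vectorGame_bias_le (hc : 1 ≤ c) (hm : 1 ≤ m) {l : ℝ} (hl : 1 ≤ l)
    (hL : 64 * hintConst c ^ 2 * l ^ 4 ≤ m) (he : ∀ r : ℕ, 1 ≤ r → r ≤ m → ∀ y : ℤ,
      epsf r y ∈ Set.Icc (-1 : ℝ) 1 ∧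
        binTail (sRound m 1) (epsf r y) 0 = binTail (sRound m (r + 1)) 0 (-y)) :
    gameBias m 0 0 (vectorHint (c * sRound m 1) epsf) b ≤
      m * (2 * Real.exp (-(l ^ 2 / 2))) + (12 * l / m + 2 * m * Real.exp (-(l ^ 2 / 2))) *
        (128 * hintConst c * l ^ 2 * (2 + Real.log m) + 64 * hintConst c ^ 2 * l ^ 4) := by
  obtain ⟨f, hf0, hf1, hf2⟩ := exists_round_bound hc hl he
  have hA := le_hintConst hc
  have hK : 0 ≤ 128 * hintConst c * l ^ 2 := by positivity
  set ω := chargeWeight m ⌊64 * hintConst c ^ 2 * l ^ 4⌋₊ (128 * hintConst c * l ^ 2)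
  have hω : ∀ j, 0 ≤ ω j := chargeWeight_nonneg hK
  have h := gameBias_le_add (b := b) (hint := vectorHint (c * sRound m 1) epsf) (f := f)
    (D := walkCharge m l ω) (δ := 2 * Real.exp (-(l ^ 2 / 2)))
    (fun r h1 h2 y v => vecProb_nonneg (abs_le.2 (he r h1 h2 y).1) v)
    (fun r _ _ y => sum_vecProb _ _) hf0 (walkCharge_nonneg m l hω)
    (fun x v i => by
      refine (hf1 i i.2 _ v).trans (add_le_add le_rfl ?_)
      by_cases hx : |(partY m 0 x i : ℝ)| ≤ l * (m - i : ℕ)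
      · rw [if_pos hx]
        exact le_walkCharge (by linarith) hω x i.2 (le_sum_chargeWeight i.2 hK) hx
      · rw [if_neg hx]
        exact walkCharge_nonneg m l hω x)
    hf2
  refine h.trans (add_le_add le_rfl ?_)
  refine (walkExp_walkCharge_le hl hω).trans (mul_le_mul_of_nonneg_left ?_ (by positivity))
  exact sum_chargeWeight_mul_le hm hK (by positivity) hL

end

theorem stmt_18 :
    ∃ φ : ℕ → ℝ, (∀ c : ℕ, 1 ≤ c → 0 < φ c) ∧
      ∀ c : ℕ, 1 ≤ c → ∀ m : ℕ, 2 ≤ m → ∀ epsf : ℕ → ℤ → ℝ,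
        (∀ r : ℕ, 1 ≤ r → r ≤ m → ∀ y : ℤ,
          epsf r y ∈ Set.Icc (-1 : ℝ) 1 ∧
            binTail (sRound m 1) (epsf r y) 0 = binTail (sRound m (r + 1)) 0 (-y)) →
        ∀ b : ℕ → ℤ → (Fin (c * sRound m 1) → Bool) → Bool,
          gameBias m 0 0 (vectorHint (c * sRound m 1) epsf) b ≤
            φ c * Real.logb 2 m ^ 3 / m := by
  refine ⟨fun c => 16 * (24576 * hintConst c + 32768 * hintConst c ^ 2), ?_, ?_⟩
  · intro c hc
    have := le_hintConst hc
    positivity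
  · intro c hc m hm epsf he b
    have hA := le_hintConst hc
    set A := hintConst c
    have hm0 : (0 : ℝ) < m := by exact_mod_cast (by omega : 0 < m)
    have hm2 : (2 : ℝ) ≤ m := by exact_mod_cast hm
    set t := Real.logb 2 m with ht
    have ht1 : 1 ≤ t := by
      rw [ht, Real.le_logb_iff_rpow_le (by norm_num) hm0, Real.rpow_one]
      exact hm2
    have hlog : Real.log m ≤ t := by
      rw [ht, Real.logb, le_div_iff₀ (Real.log_pos (by norm_num))]
      have h1 : Real.log 2 ≤ 1 := by linarith [Real.log_two_lt_d9]
      exact mul_le_of_le_one_right (Real.log_nonneg (by linarith)) h1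
    set l := Real.sqrt (8 * t) with hl
    have hll : l ^ 2 = 8 * t := Real.sq_sqrt (by linarith)
    have hl1 : 1 ≤ l := by
      rw [hl]; apply Real.le_sqrt_of_sq_le; linarith
    have hl4 : l ^ 4 = 64 * t ^ 2 := by
      rw [show l ^ 4 = (l ^ 2) ^ 2 by ring, hll]; ring
    have hl8 : l ≤ 8 * t := by rw [← hll]; nlinarith
    have ht23 : t ^ 2 ≤ t ^ 3 := pow_le_pow_right₀ ht1 (by norm_num)
    by_cases hL : 64 * A ^ 2 * l ^ 4 ≤ m
    · have hmain := vectorGame_bias_le b hc (by omega) hl1 hL he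
      have hE : Real.exp (-(l ^ 2 / 2)) ≤ 1 / m ^ 2 := by
        have h1 : -(l ^ 2 / 2) ≤ -(Real.log m + Real.log m) := by rw [hll]; linarith
        refine (Real.exp_le_exp.2 h1).trans (le_of_eq ?_)
        rw [Real.exp_neg, Real.exp_add, Real.exp_log hm0, sq, one_div]
      set B := 128 * A * l ^ 2 * (2 + Real.log m) + 64 * A ^ 2 * l ^ 4 with hB
      have hlogm : 0 ≤ Real.log m := Real.log_nonneg (by linarith)
      have hB1 : 1 ≤ B := by
        have h1 : 1 ≤ 64 * A ^ 2 := by nlinarith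
        have h2 : 1 ≤ l ^ 4 := one_le_pow₀ hl1
        have h3 : 0 ≤ 128 * A * l ^ 2 * (2 + Real.log m) := by positivity
        nlinarith
      have hmE : 2 * m * Real.exp (-(l ^ 2 / 2)) ≤ 2 / m := by
        calc _ ≤ 2 * m * (1 / (m : ℝ) ^ 2) := by gcongr
          _ = _ := by field_simp
      have hBle : l * B ≤ (24576 * A + 32768 * A ^ 2) * t ^ 3 := by
        calc l * B ≤ 8 * t * B := by gcongr
          _ ≤ 8 * t * (128 * A * (8 * t) * (3 * t) + 64 * A ^ 2 * (64 * t ^ 2)) := by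
            rw [hB, hll, hl4]
            gcongr
            linarith
          _ = _ := by ring
      have hlB : B ≤ l * B := le_mul_of_one_le_left (by linarith) hl1
      calc _ ≤ 2 * m * Real.exp (-(l ^ 2 / 2)) +
            (12 * l / m + 2 * m * Real.exp (-(l ^ 2 / 2))) * B := by linarith
        _ ≤ 2 / m + (12 * l / m + 2 / m) * B := by gcongr
        _ = (2 + 12 * (l * B) + 2 * B) / m := by ring
        _ ≤ 16 * (24576 * A + 32768 * A ^ 2) * t ^ 3 / m := by
          gcongr
          linarith
    · refine (vectorGame_bias_le_one b he).trans ?_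
      rw [le_div_iff₀ hm0, one_mul]
      rw [not_le, hl4] at hL
      have h1 : A ^ 2 * t ^ 2 ≤ A ^ 2 * t ^ 3 := by gcongr
      have h2 : 0 ≤ A * t ^ 3 := by positivity
      nlinarith
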